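/- Suppose (X, σ_X) is an irreducible shift of finite type, (Y, σ_Y) is a subshift, and π : X → Y is a factor map. Then in the compensation-function theorems the function F(y) = limsup_{n→∞}(1/n) log |D_n(y)| may be replaced by F'(y) = limsup_{n→∞}(1/n) log |π^{-1}[y_1⋯y_n]|: in particular, −F'∘π is a bounded Borel measurable saturated compensation function, i.e., for every φ ∈ C(Y), sup_{μ ∈ M(X,σ_X)}{h_μ(σ_X) + ∫(−F'∘π + φ∘π) dμ} = sup_{m ∈ M(Y,σ_Y)}{h_m(σ_Y) + ∫φ dm}. -/

import Mathlib

set_option linter.unusedSectionVars false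
set_option linter.unusedVariables false
set_option maxHeartbeats 1000000

open MeasureTheory Filter Topology Set
open scoped ENNReal NNReal Classical

namespace Paper

/-- The shift map on the full sequence space over the alphabet `A`. -/
def shiftF (A : Type*) : (ℕ → A) → (ℕ → A) := fun x i => x (i + 1)

/-- A (one-sided) subshift over the alphabet `A`: a closed shift-invariant set of sequences. -/
structure Subshift (A : Type*) [TopologicalSpace A] : Type _ where
  carrier : Set (ℕ → A)
  isClosed : IsClosed carrier
  shift_mem : ∀ x ∈ carrier, shiftF A x ∈ carrier

section Defs

variable {A B : Type*}
  [Fintype A] [TopologicalSpace A] [DiscreteTopology A]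
  [MeasurableSpace A] [MeasurableSingletonClass A]
  [Fintype B] [TopologicalSpace B] [DiscreteTopology B]
  [MeasurableSpace B] [MeasurableSingletonClass B]

/-- The points of a subshift, as a subtype of the full sequence space. -/
abbrev Subshift.pt (X : Subshift A) : Type _ := ↥X.carrier

/-- The shift map of a subshift. -/
def Subshift.σ (X : Subshift A) : X.pt → X.pt :=
  fun x => ⟨shiftF A x.1, X.shift_mem x.1 x.2⟩

/-- `M(X, σ_X)`: the set of shift-invariant Borel probability measures on the subshift. -/
def invP (X : Subshift A) : Set (ProbabilityMeasure X.pt) :=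
  {μ | μ.toMeasure.map X.σ = μ.toMeasure}

/-- The cylinder set `[w₁ ⋯ wₙ]` of a word, inside the subshift. -/
def cyl (X : Subshift A) {n : ℕ} (w : Fin n → A) : Set X.pt :=
  {x | ∀ i : Fin n, x.1 (i : ℕ) = w i}

/-- The entropy of the partition of `X` into cylinders of length `n` w.r.t. `μ`. -/
noncomputable def blockH (X : Subshift A) (μ : ProbabilityMeasure X.pt) (n : ℕ) : ℝ :=
  ∑ w : Fin n → A, Real.negMulLog ((μ.toMeasure (cyl X w)).toReal)

/-- The Kolmogorov–Sinai entropy `h_μ(σ_X)` of an invariant measure on a subshift: for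
invariant measures the sequence `blockH` is subadditive, so the infimum below is the
usual limit `lim (1/n) H_n` over the generating sequence of cylinder partitions. -/
noncomputable def KS (X : Subshift A) (μ : ProbabilityMeasure X.pt) : ℝ :=
  ⨅ n : ℕ, blockH X μ (n + 1) / (n + 1)

/-- A one-block factor map between subshifts, given by a map on symbols. -/
structure Factor (X : Subshift A) (Y : Subshift B) where
  symb : A → B
  mem : ∀ x ∈ X.carrier, (fun i => symb (x i)) ∈ Y.carrier
  surj : ∀ y ∈ Y.carrier, ∃ x ∈ X.carrier, (fun i => symb (x i)) = y

variable {X : Subshift A} {Y : Subshift B}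

/-- The factor map `π : X → Y` induced by the one-block map on symbols. -/
def Factor.map (π : Factor X Y) : X.pt → Y.pt :=
  fun x => ⟨fun i => π.symb (x.1 i), π.mem x.1 x.2⟩

lemma Factor.measurable_map (π : Factor X Y) : Measurable π.map := by
  apply Measurable.subtype_mk
  apply measurable_pi_lambda
  intro i
  exact (measurable_of_countable π.symb).comp
    ((measurable_pi_apply i).comp measurable_subtype_coe)

/-- Push-forward `π μ` of a probability measure under the factor map. -/
noncomputable def Factor.push (π : Factor X Y) (μ : ProbabilityMeasure X.pt) :
    ProbabilityMeasure Y.pt :=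
  μ.map π.measurable_map.aemeasurable

/-- A word is allowable in `X` if it occurs (initially) in some point of `X`. -/
def allowW (X : Subshift A) {n : ℕ} (w : Fin n → A) : Prop :=
  ∃ x ∈ X.carrier, ∀ i : Fin n, x (i : ℕ) = w i

/-- `|π⁻¹[v₁⋯vₙ]|`: the number of allowable `n`-words of `X` mapped by the one-block map
to the word `v`. -/
noncomputable def preCnt (π : Factor X Y) {n : ℕ} (v : Fin n → B) : ℕ :=
  Nat.card {w : Fin n → A // allowW X w ∧ ∀ i, π.symb (w i) = v i}

/-- `|D_n(y)|`: the number of length-`n` cylinders of `X` meeting the fiber `π⁻¹(y)`. -/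
noncomputable def Dcnt (π : Factor X Y) (n : ℕ) (y : Y.pt) : ℕ :=
  Nat.card {w : Fin n → A // ∃ x : X.pt, π.map x = y ∧ ∀ i : Fin n, x.1 (i : ℕ) = w i}

/-- The relative pressure function `P(σ_X, π, 0)(y) = limsup (1/n) log |D_n(y)|`. -/
noncomputable def relP (π : Factor X Y) (y : Y.pt) : ℝ :=
  Filter.limsup (fun n : ℕ => Real.log (Dcnt π n y) / n) Filter.atTop

/-- The function `y ↦ limsup (1/n) log |π⁻¹[y₁⋯yₙ]|`. -/
noncomputable def relP' (π : Factor X Y) (y : Y.pt) : ℝ :=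
  Filter.limsup (fun n : ℕ => Real.log (preCnt π (fun i : Fin n => y.1 (i : ℕ))) / n)
    Filter.atTop

/-- `h_μ(σ) + ∫ f dμ`, as an extended real number. -/
noncomputable def wtF (X : Subshift A) (f : X.pt → ℝ) (μ : ProbabilityMeasure X.pt) : EReal :=
  (KS X μ : EReal) + ((∫ x, f x ∂μ.toMeasure : ℝ) : EReal)

/-- `lim (1/n) ∫ φ_n dμ` for a subadditive sequence `Φ`; for invariant `μ` the limit exists
in `[-∞, ∞)` and equals the infimum below, by subadditivity. -/
noncomputable def potLim (X : Subshift A) (Φ : ℕ → X.pt → ℝ)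
    (μ : ProbabilityMeasure X.pt) : EReal :=
  ⨅ n : ℕ, (((∫ x, Φ (n + 1) x ∂μ.toMeasure) / (n + 1) : ℝ) : EReal)

/-- `h_μ(σ) + ∫ f dμ + lim (1/n) ∫ φ_n dμ`. -/
noncomputable def wtFP (X : Subshift A) (f : X.pt → ℝ) (Φ : ℕ → X.pt → ℝ)
    (μ : ProbabilityMeasure X.pt) : EReal :=
  wtF X f μ + potLim X Φ μ

/-- `h_μ(σ) + lim (1/n) ∫ φ_n dμ`. -/
noncomputable def wtP (X : Subshift A) (Φ : ℕ → X.pt → ℝ)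
    (μ : ProbabilityMeasure X.pt) : EReal :=
  (KS X μ : EReal) + potLim X Φ μ

/-- `h_μ(σ) - lim (1/n) ∫ φ_n dμ`: the weight of the superadditive potential `-Φ`,
for `Φ` subadditive. -/
noncomputable def wtN (X : Subshift A) (Φ : ℕ → X.pt → ℝ)
    (μ : ProbabilityMeasure X.pt) : EReal :=
  (KS X μ : EReal) - potLim X Φ μ

/-- `M_f(X, σ_X)`: equilibrium states of a bounded Borel measurable function `f`. -/
def eqF (X : Subshift A) (f : X.pt → ℝ) : Set (ProbabilityMeasure X.pt) :=
  {μ | μ ∈ invP X ∧ wtF X f μ = sSup (wtF X f '' invP X)}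

/-- `M_{f+Φ}(X, σ_X)`: equilibrium states of `f + Φ`, `Φ` a subadditive potential. -/
def eqFP (X : Subshift A) (f : X.pt → ℝ) (Φ : ℕ → X.pt → ℝ) :
    Set (ProbabilityMeasure X.pt) :=
  {μ | μ ∈ invP X ∧ wtFP X f Φ μ = sSup (wtFP X f Φ '' invP X)}

/-- `M_Φ(X, σ_X)`: equilibrium states of a subadditive potential `Φ`. -/
def eqP (X : Subshift A) (Φ : ℕ → X.pt → ℝ) : Set (ProbabilityMeasure X.pt) :=
  {μ | μ ∈ invP X ∧ wtP X Φ μ = sSup (wtP X Φ '' invP X)}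

/-- `M_{-Φ}(X, σ_X)`: equilibrium states of `-Φ`, for `Φ` a subadditive potential. -/
def eqN (X : Subshift A) (Φ : ℕ → X.pt → ℝ) : Set (ProbabilityMeasure X.pt) :=
  {μ | μ ∈ invP X ∧ wtN X Φ μ = sSup (wtN X Φ '' invP X)}

/-- `μ` is a measure of maximal relative entropy over `m`. -/
def maxRelOver (π : Factor X Y) (m : ProbabilityMeasure Y.pt)
    (μ : ProbabilityMeasure X.pt) : Prop :=
  μ ∈ invP X ∧ π.push μ = m ∧
    KS X μ = sSup (KS X '' {ν | ν ∈ invP X ∧ π.push ν = m})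

/-- A subadditive potential: a sequence of continuous functions satisfying the
subadditivity condition (`Φ n` is the paper's `φ_n` for `n ≥ 1`). -/
def SubAdd (X : Subshift A) (Φ : ℕ → X.pt → ℝ) : Prop :=
  (∀ n : ℕ, 0 < n → Continuous (Φ n)) ∧
  ∀ n m : ℕ, 0 < n → 0 < m → ∀ x : X.pt, Φ (n + m) x ≤ Φ n x + Φ m (X.σ^[n] x)

/-- An almost additive potential. -/
def AlmostAdd (X : Subshift A) (Φ : ℕ → X.pt → ℝ) : Prop :=
  (∀ n : ℕ, 0 < n → Continuous (Φ n)) ∧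
  ∃ C : ℝ, 0 < C ∧ ∀ n m : ℕ, 0 < n → 0 < m → ∀ x : X.pt,
    -C + Φ n x + Φ m (X.σ^[n] x) ≤ Φ (n + m) x ∧
    Φ (n + m) x ≤ C + Φ n x + Φ m (X.σ^[n] x)

/-- The metric on the sequence space: `d(x,y) = (1/2)^k` where `k` is the first index at
which `x` and `y` differ, and `d(x,y) = 0` if `x = y`. -/
noncomputable def dSeq (x y : ℕ → A) : ℝ :=
  if x = y then 0 else (1 / 2 : ℝ) ^ sInf {n : ℕ | x n ≠ y n}

/-- An `(n, ε)`-separated (finite) subset of the subshift. -/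
def SepSet (Y : Subshift B) (n : ℕ) (ε : ℝ) (E : Finset Y.pt) : Prop :=
  ∀ x ∈ E, ∀ y ∈ E, x ≠ y → ∃ i < n, ε < dSeq ((Y.σ^[i] x) : Y.pt).1 ((Y.σ^[i] y) : Y.pt).1

/-- `P_n(σ_Y, Φ, ε)`: the supremum of `∑_{y ∈ E} exp (φ_n y)` over `(n,ε)`-separated
sets `E`. -/
noncomputable def PnV (Y : Subshift B) (Φ : ℕ → Y.pt → ℝ) (n : ℕ) (ε : ℝ) : ℝ :=
  sSup {r : ℝ | ∃ E : Finset Y.pt, SepSet Y n ε E ∧ r = ∑ y ∈ E, Real.exp (Φ n y)}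

/-- The subadditive topological pressure `P(σ_Y, Φ) = lim_{ε→0} limsup (1/n) log P_n(σ,Φ,ε)`;
since the inner quantity is monotone as `ε` decreases, the limit as `ε → 0⁺` is the
supremum over `ε > 0`. -/
noncomputable def Press (Y : Subshift B) (Φ : ℕ → Y.pt → ℝ) : EReal :=
  ⨆ (ε : ℝ) (_ : 0 < ε),
    Filter.limsup (fun n : ℕ => ((Real.log (PnV Y Φ n ε) / n : ℝ) : EReal)) Filter.atTop

/-- `X` is a shift of finite type (a 1-step topological Markov shift). -/
def IsSFT (X : Subshift A) : Prop :=
  ∃ Tr : A → A → Prop, X.carrier = {x | ∀ i : ℕ, Tr (x i) (x (i + 1))}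

/-- `X` is irreducible: any two allowable words can be joined by some connecting word. -/
def Irr (X : Subshift A) : Prop :=
  ∀ (m n : ℕ) (u : Fin m → A) (v : Fin n → A), allowW X u → allowW X v →
    ∃ (k : ℕ) (w : Fin k → A), allowW X (Fin.append (Fin.append u w) v)

/-- `X` is topologically mixing: any two allowable words can be joined by connecting words
of all sufficiently large lengths. -/
def Mix (X : Subshift A) : Prop :=
  ∀ (m n : ℕ) (u : Fin m → A) (v : Fin n → A), allowW X u → allowW X v →
    ∃ N : ℕ, ∀ k ≥ N, ∃ w : Fin k → A, allowW X (Fin.append (Fin.append u w) v)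

/-- `M` is a mixing gap for the SFT `X`: any two symbols occurring in `X` are joined by an
allowable word of length `M + 1` (this encodes `A^M > 0` for the transition matrix `A`). -/
def MixGap (X : Subshift A) (M : ℕ) : Prop :=
  ∀ a b : A, allowW X (fun _ : Fin 1 => a) → allowW X (fun _ : Fin 1 => b) →
    ∃ w : Fin (M + 1) → A, allowW X w ∧ w 0 = a ∧ w (Fin.last M) = b

/-- A Gibbs measure for the sequence of potentials `Φ` on the subshift `Y`: there are
`C > 0` and `P` with `1/C < μ[y₁⋯yₙ] / exp(-nP + φ_n(y)) < C` for all `y` and `n ≥ 1`. -/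
def IsGibbs (Y : Subshift B) (Φ : ℕ → Y.pt → ℝ) (μ : ProbabilityMeasure Y.pt) : Prop :=
  ∃ C : ℝ, 0 < C ∧ ∃ P : ℝ, ∀ n : ℕ, 0 < n → ∀ y : Y.pt,
    1 / C < (μ.toMeasure (cyl Y (fun i : Fin n => y.1 (i : ℕ)))).toReal /
        Real.exp (-(n : ℝ) * P + Φ n y) ∧
      (μ.toMeasure (cyl Y (fun i : Fin n => y.1 (i : ℕ)))).toReal /
        Real.exp (-(n : ℝ) * P + Φ n y) < C

/-- A measure is mixing for the map `f`. -/
def MixingM {Ω : Type*} [MeasurableSpace Ω] (f : Ω → Ω) (μ : Measure Ω) : Prop :=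
  ∀ s t : Set Ω, MeasurableSet s → MeasurableSet t →
    Filter.Tendsto (fun n : ℕ => (μ (s ∩ f^[n] ⁻¹' t)).toReal) Filter.atTop
      (nhds ((μ s).toReal * (μ t).toReal))

/-- The potential `φ_n(y) = log |π⁻¹[y₁⋯yₙ]|^{1/(α+1)}`. -/
noncomputable def phiPre (π : Factor X Y) (α : ℝ) (n : ℕ) (y : Y.pt) : ℝ :=
  Real.log (((preCnt π (fun i : Fin n => y.1 (i : ℕ)) : ℝ)) ^ (1 / (α + 1) : ℝ))

/-- The potential `φ'_n(y) = log |D_n(y)|^{1/(α+1)}`. -/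
noncomputable def phiD (π : Factor X Y) (α : ℝ) (n : ℕ) (y : Y.pt) : ℝ :=
  Real.log (((Dcnt π n y : ℝ)) ^ (1 / (α + 1) : ℝ))

/-- `S_n = ∑_{v ∈ B_n(Y)} |π⁻¹[v]|^{1/(α+1)}` (non-allowable words contribute `0` since
then `|π⁻¹[v]| = 0`). -/
noncomputable def Sval (π : Factor X Y) (α : ℝ) (n : ℕ) : ℝ :=
  ∑ v : Fin n → B, ((preCnt π v : ℝ)) ^ (1 / (α + 1) : ℝ)

/-- `M_{-F∘π + Φ∘π}(X, σ_X)` for `F = P(σ_X, π, 0)` and `Φ` a subadditive potential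
on `Y`. -/
noncomputable def compEq (π : Factor X Y) (Φ : ℕ → Y.pt → ℝ) :
    Set (ProbabilityMeasure X.pt) :=
  eqFP X (fun x => -relP π (π.map x)) (fun n x => Φ n (π.map x))

/-- The weighted entropy functional `h_μ(σ_X) + α h_{πμ}(σ_Y)`. -/
noncomputable def wtAlpha (π : Factor X Y) (α : ℝ) (μ : ProbabilityMeasure X.pt) : EReal :=
  (KS X μ : EReal) + (α : EReal) * (KS Y (π.push μ) : EReal)

/-- `K_α`: the set of invariant measures maximizing `h_μ(σ_X) + α h_{πμ}(σ_Y)`. -/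
noncomputable def Kalpha (π : Factor X Y) (α : ℝ) : Set (ProbabilityMeasure X.pt) :=
  {μ | μ ∈ invP X ∧ wtAlpha π α μ = sSup (wtAlpha π α '' invP X)}

end Defs

/-! ### The torus, the expanding map `T`, and carpets -/

/-- The two-torus. -/
abbrev T2 : Type := AddCircle (1 : ℝ) × AddCircle (1 : ℝ)

/-- The endomorphism `T(x, y) = (l x mod 1, m y mod 1)` of the torus. -/
noncomputable def Tmap (l m : ℕ) : T2 → T2 := fun p => (l • p.1, m • p.2)

/-- The coding map `χ` associated to the Markov partition of `T`. -/
noncomputable def chi (l m : ℕ) (x : ℕ → Fin l × Fin m) : T2 :=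
  (((∑' k : ℕ, (((x k).1 : ℕ) : ℝ) / l ^ (k + 1) : ℝ) : AddCircle (1:ℝ)),
   ((∑' k : ℕ, (((x k).2 : ℕ) : ℝ) / m ^ (k + 1) : ℝ) : AddCircle (1:ℝ)))

/-- The Hausdorff dimension of a measure: the infimum of the Hausdorff dimensions of
sets of full measure. -/
noncomputable def dimHMeas {Ω : Type*} [EMetricSpace Ω] [MeasurableSpace Ω]
    (μ : Measure Ω) : ℝ≥0∞ :=
  ⨅ (s : Set Ω) (_ : μ s = 1), dimH s

/-- `μ` is a `T`-invariant ergodic Borel probability measure of full Hausdorff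
dimension for the compact invariant set `K`. -/
def FullDimErg (l m : ℕ) (K : Set T2) (μ : Measure T2) : Prop :=
  IsProbabilityMeasure μ ∧ Ergodic (Tmap l m) μ ∧ μ K = 1 ∧ dimHMeas μ = dimH K

/-- The coding map restricted to a carpet subshift. -/
noncomputable def chiPt {l m : ℕ} (X : Subshift (Fin l × Fin m)) (x : X.pt) : T2 :=
  chi l m x.1



section PureLemmas

lemma gibbs_term {p q : ℝ} (hp : 0 ≤ p) (hq : 0 ≤ q) (h : p ≠ 0 → q ≠ 0) :
    Real.negMulLog p + p * Real.log q ≤ q - p := by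
  rcases eq_or_lt_of_le hp with h0 | h0
  · subst h0; simpa using hq
  · have hq0 : 0 < q := lt_of_le_of_ne hq (Ne.symm (h h0.ne'))
    have h1 := Real.log_le_sub_one_of_pos (div_pos hq0 h0)
    rw [Real.log_div hq0.ne' h0.ne'] at h1
    have h2 := mul_le_mul_of_nonneg_left h1 hp
    have h3 : p * (q / p - 1) = q - p := by field_simp
    rw [h3] at h2
    unfold Real.negMulLog
    linarith

lemma gibbs_ineq {U : Type*} [Fintype U] (p q : U → ℝ) (hp : ∀ w, 0 ≤ p w) (hq : ∀ w, 0 ≤ q w)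
    (hp1 : ∑ w, p w = 1) (hq1 : ∑ w, q w ≤ 1) (h : ∀ w, p w ≠ 0 → q w ≠ 0) :
    ∑ w, Real.negMulLog (p w) ≤ - ∑ w, p w * Real.log (q w) := by
  have h1 : ∑ w, (Real.negMulLog (p w) + p w * Real.log (q w)) ≤ ∑ w, (q w - p w) :=
    Finset.sum_le_sum fun w _ => gibbs_term (hp w) (hq w) (h w)
  rw [Finset.sum_add_distrib, Finset.sum_sub_distrib] at h1
  linarith

lemma marg_sum {U S : Type*} [Fintype U] [Fintype S] (p : U → ℝ) (u : U → S) (pS : S → ℝ)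
    (hS : ∀ s, pS s = ∑ w, if u w = s then p w else 0) (g : S → ℝ) :
    ∑ w, p w * g (u w) = ∑ s, pS s * g s := by
  simp_rw [hS, Finset.sum_mul]
  rw [Finset.sum_comm]
  refine Finset.sum_congr rfl fun w _ => ?_
  rw [Finset.sum_eq_single (u w)]
  · simp
  · intro s _ hs
    simp [Ne.symm hs]
  · simp

lemma marg_total {U S : Type*} [Fintype U] [Fintype S] (p : U → ℝ) (u : U → S) (pS : S → ℝ)
    (hS : ∀ s, pS s = ∑ w, if u w = s then p w else 0) :
    ∑ s, pS s = ∑ w, p w := by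
  have := marg_sum p u pS hS (fun _ => 1)
  simpa using this.symm

lemma marg_nonneg {U S : Type*} [Fintype U] [Fintype S] (p : U → ℝ) (hp : ∀ w, 0 ≤ p w)
    (u : U → S) (pS : S → ℝ)
    (hS : ∀ s, pS s = ∑ w, if u w = s then p w else 0) (s : S) : 0 ≤ pS s := by
  rw [hS]
  exact Finset.sum_nonneg fun w _ => by split_ifs <;> simp [hp]

lemma marg_ge {U S : Type*} [Fintype U] [Fintype S] (p : U → ℝ) (hp : ∀ w, 0 ≤ p w)
    (u : U → S) (pS : S → ℝ)
    (hS : ∀ s, pS s = ∑ w, if u w = s then p w else 0) (w : U) : p w ≤ pS (u w) := by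
  rw [hS]
  have := Finset.single_le_sum (f := fun w' => if u w' = u w then p w' else 0)
    (fun w' _ => by split_ifs <;> simp [hp]) (Finset.mem_univ w)
  simpa using this

lemma ent_pair {U S T : Type*} [Fintype U] [Fintype S] [Fintype T] (p : U → ℝ)
    (hp : ∀ w, 0 ≤ p w) (hp1 : ∑ w, p w = 1) (u : U → S) (v : U → T)
    (hinj : Function.Injective fun w => (u w, v w)) (pS : S → ℝ) (pT : T → ℝ)
    (hS : ∀ s, pS s = ∑ w, if u w = s then p w else 0)
    (hT : ∀ s, pT s = ∑ w, if v w = s then p w else 0) :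
    ∑ w, Real.negMulLog (p w) ≤ ∑ s, Real.negMulLog (pS s) + ∑ t, Real.negMulLog (pT t) := by
  have pS0 := marg_nonneg p hp u pS hS
  have pT0 := marg_nonneg p hp v pT hT
  have key := gibbs_ineq p (fun w => pS (u w) * pT (v w)) hp
    (fun w => mul_nonneg (pS0 _) (pT0 _)) hp1 ?_ ?_
  · refine key.trans (le_of_eq ?_)
    have e : ∀ w, p w * Real.log (pS (u w) * pT (v w))
        = p w * Real.log (pS (u w)) + p w * Real.log (pT (v w)) := by
      intro w
      by_cases h0 : p w = 0
      · simp [h0]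
      · have hw : 0 < p w := lt_of_le_of_ne (hp w) (Ne.symm h0)
        have h1 := marg_ge p hp u pS hS w
        have h2 := marg_ge p hp v pT hT w
        rw [Real.log_mul (by linarith) (by linarith)]; ring
    simp_rw [e]
    rw [Finset.sum_add_distrib, marg_sum p u pS hS (fun s => Real.log (pS s)),
      marg_sum p v pT hT (fun s => Real.log (pT s))]
    simp only [Real.negMulLog, neg_mul, Finset.sum_neg_distrib]
    ring
  · have h1 : ∑ w, pS (u w) * pT (v w)
        = ∑ z ∈ Finset.univ.image (fun w => (u w, v w)), pS z.1 * pT z.2 := by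
      rw [Finset.sum_image (fun a _ b _ h => hinj h)]
    rw [h1]
    calc _ ≤ ∑ z : S × T, pS z.1 * pT z.2 :=
          Finset.sum_le_sum_of_subset_of_nonneg (Finset.subset_univ _)
            (fun z _ _ => mul_nonneg (pS0 _) (pT0 _))
      _ = (∑ s, pS s) * ∑ t, pT t := by
          rw [Fintype.sum_prod_type, Finset.sum_mul_sum]
      _ ≤ 1 := by
          rw [marg_total p u pS hS, marg_total p v pT hT, hp1]; simp
  · intro w h0
    have hw : 0 < p w := lt_of_le_of_ne (hp w) (Ne.symm h0)
    have h1 := marg_ge p hp u pS hS w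
    have h2 := marg_ge p hp v pT hT w
    have : 0 < pS (u w) * pT (v w) := mul_pos (by linarith) (by linarith)
    exact this.ne'

lemma ent_card {U : Type*} [Fintype U] (p : U → ℝ)
    (hp : ∀ w, 0 ≤ p w) (hp1 : ∑ w, p w = 1) :
    ∑ w, Real.negMulLog (p w) ≤ Real.log (Fintype.card U) := by
  have hU : (0 : ℝ) < Fintype.card U := by
    have : Nonempty U := by
      by_contra h
      rw [not_nonempty_iff] at h
      simp at hp1
    exact_mod_cast Fintype.card_pos
  have key := gibbs_ineq p (fun _ => (Fintype.card U : ℝ)⁻¹) hp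
    (fun w => by positivity) hp1 ?_ ?_
  · refine key.trans (le_of_eq ?_)
    rw [← Finset.sum_mul, hp1, Real.log_inv]; ring
  · simp [hU.ne']
  · intro w _; exact (inv_pos.mpr hU).ne'

lemma card_fiber_sum {U S : Type*} [Fintype U] [Fintype S] (u : U → S) (P : U → Prop)
    (g : S → ℝ) :
    ∑ w, (if P w then g (u w) else 0)
      = ∑ s, (Nat.card {w : U // P w ∧ u w = s} : ℝ) * g s := by
  have h : ∀ s, (Nat.card {w : U // P w ∧ u w = s} : ℝ)
      = ∑ w, if u w = s then (if P w then (1:ℝ) else 0) else 0 := by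
    intro s
    rw [Nat.card_eq_fintype_card, Fintype.card_subtype]
    simp only [← ite_and, Finset.sum_boole]
    congr 2
    ext w; simp [and_comm]
  rw [← marg_sum _ u _ h g]
  refine Finset.sum_congr rfl fun w _ => ?_
  split_ifs <;> simp

lemma ent_fiber {U S : Type*} [Fintype U] [Fintype S] (p : U → ℝ)
    (hp : ∀ w, 0 ≤ p w) (hp1 : ∑ w, p w = 1) (u : U → S) (P : U → Prop)
    (hP : ∀ w, p w ≠ 0 → P w) (pS : S → ℝ)
    (hS : ∀ s, pS s = ∑ w, if u w = s then p w else 0) :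
    ∑ w, Real.negMulLog (p w) ≤ ∑ s, Real.negMulLog (pS s)
      + ∑ s, pS s * Real.log (Nat.card {w : U // P w ∧ u w = s}) := by
  have pS0 := marg_nonneg p hp u pS hS
  set N : S → ℝ := fun s => (Nat.card {w : U // P w ∧ u w = s} : ℝ) with hN
  have hN0 : ∀ s, 0 ≤ N s := fun s => Nat.cast_nonneg _
  have hNpos : ∀ w, P w → 0 < N (u w) := by
    intro w hw
    have : Nonempty {w' : U // P w' ∧ u w' = u w} := ⟨⟨w, hw, rfl⟩⟩
    exact Nat.cast_pos.mpr Nat.card_pos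
  have key := gibbs_ineq p (fun w => if P w then pS (u w) / N (u w) else 0) hp
    (fun w => by split_ifs <;> [exact div_nonneg (pS0 _) (hN0 _); exact le_rfl])
    hp1 ?_ ?_
  · refine key.trans (le_of_eq ?_)
    have e : ∀ w, p w * Real.log (if P w then pS (u w) / N (u w) else 0)
        = p w * Real.log (pS (u w)) - p w * Real.log (N (u w)) := by
      intro w
      by_cases h0 : p w = 0
      · simp [h0]
      · have hw : 0 < p w := lt_of_le_of_ne (hp w) (Ne.symm h0)
        have h1 := marg_ge p hp u pS hS w
        have h2 := hNpos w (hP w h0)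
        rw [if_pos (hP w h0), Real.log_div (by linarith) (by linarith)]; ring
    simp_rw [e]
    rw [Finset.sum_sub_distrib, marg_sum p u pS hS (fun s => Real.log (pS s)),
      marg_sum p u pS hS (fun s => Real.log (N s))]
    simp only [Real.negMulLog, neg_mul, Finset.sum_neg_distrib]
    ring
  · rw [card_fiber_sum u P (fun s => pS s / N s)]
    rw [← hp1, ← marg_total p u pS hS]
    refine Finset.sum_le_sum fun s _ => ?_
    change N s * (pS s / N s) ≤ pS s
    rcases eq_or_lt_of_le (hN0 s) with h | h
    · rw [← h]; simpa using pS0 s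
    · rw [mul_div_cancel₀ _ h.ne']
  · intro w h0
    have hw : 0 < p w := lt_of_le_of_ne (hp w) (Ne.symm h0)
    have h1 := marg_ge p hp u pS hS w
    rw [if_pos (hP w h0)]
    exact (div_pos (by linarith) (hNpos w (hP w h0))).ne'

lemma subadd_array (a : ℕ → ℕ → ℝ) (C : ℝ) (hC : 0 ≤ C) (h0 : ∀ i l, 0 ≤ a i l)
    (hb : ∀ i l, a i l ≤ l * C) (hsub : ∀ i l l', a i (l + l') ≤ a i l + a (i + l) l')
    (q N : ℕ) :
    q * a 0 (N + q) ≤ ∑ i ∈ Finset.range (N + q), a i q + 2 * (q : ℝ) ^ 2 * C := by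
  set b : ℕ → ℝ := fun i => a i (N + q - i) with hbdef
  have e1 : ∑ i ∈ Finset.range N, b i ≤ ∑ i ∈ Finset.range N, a i q
      + ∑ i ∈ Finset.range N, b (q + i) := by
    rw [← Finset.sum_add_distrib]
    refine Finset.sum_le_sum fun i hi => ?_
    have hi' := Finset.mem_range.mp hi
    have := hsub i q (N - i)
    simp only [hbdef]
    have e : N + q - i = q + (N - i) := by omega
    have e' : N + q - (q + i) = N - i := by omega
    rw [e, e', add_comm q i]
    exact this
  have e2 : ∑ i ∈ Finset.range N, b i + ∑ i ∈ Finset.range q, b (N + i)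
      = ∑ i ∈ Finset.range q, b i + ∑ i ∈ Finset.range N, b (q + i) := by
    rw [← Finset.sum_range_add, ← Finset.sum_range_add, add_comm N q]
  have e3 : ∑ i ∈ Finset.range q, b (N + i) ≤ q * (q * C) := by
    calc _ ≤ ∑ i ∈ Finset.range q, (q * C : ℝ) := by
          refine Finset.sum_le_sum fun i hi => (hb _ _).trans ?_
          gcongr
          omega
      _ = _ := by simp
  have e4 : (q : ℝ) * (b 0 - q * C) ≤ ∑ i ∈ Finset.range q, b i := by
    calc (q : ℝ) * (b 0 - q * C) = ∑ i ∈ Finset.range q, (b 0 - q * C) := by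
          rw [Finset.sum_const, Finset.card_range, nsmul_eq_mul]
      _ ≤ _ := by
          refine Finset.sum_le_sum fun i hi => ?_
          have hi' := Finset.mem_range.mp hi
          have h1 := hsub 0 i (N + q - i)
          have h2 := hb 0 i
          have h3 : (i : ℝ) * C ≤ q * C := by gcongr
          simp only [hbdef]
          have e : i + (N + q - i) = N + q - 0 := by omega
          rw [e, zero_add] at h1
          linarith
  have e5 : ∑ i ∈ Finset.range N, a i q ≤ ∑ i ∈ Finset.range (N + q), a i q :=
    Finset.sum_le_sum_of_subset_of_nonneg
      (Finset.range_subset_range.mpr (by omega)) (fun i _ _ => h0 _ _)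
  have e6 : b 0 = a 0 (N + q) := by simp [hbdef]
  rw [← e6]
  nlinarith [e1, e2, e3, e4, e5]

end PureLemmas

section ErgodicLemmas

variable {Ω : Type*} [MeasurableSpace Ω]

noncomputable def maxSum (T : Ω → Ω) (h : Ω → ℝ) : ℕ → Ω → ℝ
  | 0 => fun _ => 0
  | (n + 1) => fun x => max 0 (h x + maxSum T h n (T x))

lemma maxSum_nonneg (T : Ω → Ω) (h : Ω → ℝ) (n : ℕ) (x : Ω) : 0 ≤ maxSum T h n x := by
  cases n with
  | zero => exact le_rfl
  | succ n => exact le_max_left _ _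

lemma maxSum_mono (T : Ω → Ω) (h : Ω → ℝ) (n : ℕ) :
    ∀ x : Ω, maxSum T h n x ≤ maxSum T h (n + 1) x := by
  induction n with
  | zero => intro x; exact maxSum_nonneg T h 1 x
  | succ n ih =>
    intro x
    exact max_le_max le_rfl (by gcongr; exact ih (T x))

lemma maxSum_ge (T : Ω → Ω) (h : Ω → ℝ) (n : ℕ) :
    ∀ x : Ω, birkhoffSum T h n x ≤ maxSum T h n x := by
  induction n with
  | zero => intro x; simp [birkhoffSum_zero, maxSum]
  | succ n ih =>
    intro x
    rw [birkhoffSum_succ']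
    exact le_max_of_le_right (by gcongr; exact ih (T x))

lemma maxSum_le (T : Ω → Ω) (h : Ω → ℝ) (C : ℝ) (hC0 : 0 ≤ C) (hC : ∀ x, |h x| ≤ C) (n : ℕ) :
    ∀ x : Ω, maxSum T h n x ≤ n * C := by
  induction n with
  | zero => intro x; simp [maxSum]
  | succ n ih =>
    intro x
    refine max_le (by positivity) ?_
    have h1 := ih (T x)
    have h2 := (abs_le.mp (hC x)).2
    push_cast
    linarith

lemma maxSum_measurable (T : Ω → Ω) (hT : Measurable T) (h : Ω → ℝ) (hh : Measurable h) (n : ℕ) :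
    Measurable (maxSum T h n) := by
  induction n with
  | zero => exact measurable_const
  | succ n ih => exact measurable_const.max (hh.add (ih.comp hT))

lemma integrable_of_bdd (μ : Measure Ω) [IsFiniteMeasure μ] (f : Ω → ℝ) (hf : Measurable f) (C : ℝ)
    (hC : ∀ x, |f x| ≤ C) : Integrable f μ :=
  Integrable.of_bound hf.aestronglyMeasurable C (ae_of_all _ hC)

/-- Maximal ergodic theorem (Garsia's argument). -/
lemma max_ergodic (μ : Measure Ω) [IsProbabilityMeasure μ] (T : Ω → Ω)
    (hT : MeasurePreserving T μ μ) (h : Ω → ℝ) (hh : Measurable h) (C : ℝ) (hC : ∀ x, |h x| ≤ C)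
    (hpos : ∀ x, ∃ n, 0 < birkhoffSum T h n x) : 0 ≤ ∫ x, h x ∂μ := by
  have hΩ : Nonempty Ω := nonempty_of_isProbabilityMeasure μ
  have hC0 : 0 ≤ C := (abs_nonneg _).trans (hC hΩ.some)
  have hmeas := maxSum_measurable T hT.measurable h hh
  have hmaxI : ∀ n, Integrable (maxSum T h n) μ := fun n =>
    integrable_of_bdd μ _ (hmeas n) (n * C) fun x => by
      rw [abs_of_nonneg (maxSum_nonneg _ _ _ _)]; exact maxSum_le T h C hC0 hC n x
  have hintT : ∀ n, Integrable (fun x => maxSum T h n (T x)) μ := fun n =>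
    integrable_of_bdd μ _ ((hmeas n).comp hT.measurable) (n * C) fun x => by
      rw [abs_of_nonneg (maxSum_nonneg _ _ _ _)]; exact maxSum_le T h C hC0 hC n _
  have hE : ∀ n, MeasurableSet {x | 0 < maxSum T h n x} := fun n =>
    measurableSet_lt measurable_const (hmeas n)
  have hindm : ∀ n, Measurable (indicator {x | 0 < maxSum T h n x} h) := fun n =>
    hh.indicator (hE n)
  have hindb : ∀ n x, |indicator {x | 0 < maxSum T h n x} h x| ≤ C := fun n x => by
    by_cases hx : x ∈ {x | 0 < maxSum T h n x}
    · rw [indicator_of_mem hx]; exact hC x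
    · rw [indicator_of_notMem hx]; simpa using hC0
  have h1 : ∀ n, 0 ≤ ∫ x, indicator {x | 0 < maxSum T h n x} h x ∂μ := by
    intro n
    have e1 : ∫ x, (maxSum T h n x - maxSum T h n (T x)) ∂μ = 0 := by
      rw [integral_sub (hmaxI n) (hintT n)]
      have : ∫ x, maxSum T h n (T x) ∂μ = ∫ x, maxSum T h n x ∂μ := by
        conv_rhs => rw [← hT.map_eq]
        rw [integral_map hT.aemeasurable (hmeas n).aestronglyMeasurable]
      rw [this, sub_self]
    refine e1.ge.trans ?_
    refine integral_mono ((hmaxI n).sub (hintT n))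
      (integrable_of_bdd μ _ (hindm n) C (hindb n)) fun x => ?_
    dsimp only
    by_cases hx : 0 < maxSum T h n x
    · rw [indicator_of_mem (by exact hx)]
      cases n with
      | zero => simp [maxSum] at hx
      | succ n =>
        have h2 : maxSum T h (n + 1) x = h x + maxSum T h n (T x) := by
          change max 0 (h x + maxSum T h n (T x)) = _
          change 0 < max 0 (h x + maxSum T h n (T x)) at hx
          rcases lt_max_iff.mp hx with h3 | h3
          · exact absurd h3 (lt_irrefl _)
          · exact max_eq_right h3.le
        have h3 := maxSum_mono T h n (T x)
        linarith
    · rw [indicator_of_notMem (by exact hx)]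
      have := maxSum_nonneg T h n (T x)
      linarith [not_lt.mp hx]
  have h2 : Tendsto (fun n => ∫ x, indicator {x | 0 < maxSum T h n x} h x ∂μ) atTop
      (𝓝 (∫ x, h x ∂μ)) := by
    refine tendsto_integral_of_dominated_convergence (fun _ => C)
      (fun n => (hindm n).aestronglyMeasurable) (integrable_const C)
      (fun n => ae_of_all _ (hindb n)) (ae_of_all _ fun x => ?_)
    obtain ⟨n, hn⟩ := hpos x
    refine tendsto_const_nhds.congr' ?_
    filter_upwards [eventually_ge_atTop n] with k hk
    have hmono : Monotone fun n => maxSum T h n x :=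
      monotone_nat_of_le_succ fun n => maxSum_mono T h n x
    have : 0 < maxSum T h k x := (hn.trans_le (maxSum_ge T h n x)).trans_le (hmono hk)
    rw [indicator_of_mem (by exact this)]
  exact ge_of_tendsto' h2 h1

lemma limsup_bounds {u : ℕ → ℝ} {C : ℝ} (h0 : ∀ n, 0 ≤ u n) (hC : ∀ n, u n ≤ C) :
    IsBoundedUnder (· ≤ ·) atTop u ∧ IsCoboundedUnder (· ≤ ·) atTop u ∧
      0 ≤ limsup u atTop ∧ limsup u atTop ≤ C := by
  have hb : IsBoundedUnder (· ≤ ·) atTop u := isBoundedUnder_of ⟨C, hC⟩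
  have hb' : IsBoundedUnder (· ≥ ·) atTop u := isBoundedUnder_of ⟨0, h0⟩
  have hcb : IsCoboundedUnder (· ≤ ·) atTop u := hb'.isCoboundedUnder_le
  refine ⟨hb, hcb, ?_, ?_⟩
  · exact le_limsup_of_frequently_le (Frequently.of_forall h0) hb
  · exact limsup_le_of_le hcb (Eventually.of_forall hC)

lemma birkhoffSum_bounds (T : Ω → Ω) (g : Ω → ℝ) (C : ℝ) (h0 : ∀ x, 0 ≤ g x) (hC : ∀ x, g x ≤ C)
    (n : ℕ) (x : Ω) : 0 ≤ birkhoffSum T g n x ∧ birkhoffSum T g n x ≤ n * C := by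
  unfold birkhoffSum
  constructor
  · exact Finset.sum_nonneg fun _ _ => h0 _
  · calc _ ≤ ∑ i ∈ Finset.range n, C := Finset.sum_le_sum fun _ _ => hC _
      _ = _ := by simp

lemma div_nat_bounds {a C : ℝ} (n : ℕ) (hC : 0 ≤ C) (h : 0 ≤ a ∧ a ≤ n * C) :
    0 ≤ a / n ∧ a / n ≤ C := by
  refine ⟨div_nonneg h.1 (Nat.cast_nonneg _), ?_⟩
  exact div_le_of_le_mul₀ (Nat.cast_nonneg _) hC (by rw [mul_comm]; exact h.2)

lemma tendsto_const_div_nat (c : ℝ) : Tendsto (fun n : ℕ => c / n) atTop (𝓝 0) :=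
  tendsto_const_div_atTop_nhds_zero_nat c

lemma limsup_birkhoff_shift (T : Ω → Ω) (g : Ω → ℝ) (C : ℝ) (hC0 : 0 ≤ C)
    (h0 : ∀ x, 0 ≤ g x) (hC : ∀ x, g x ≤ C) (x : Ω) :
    limsup (fun n : ℕ => birkhoffSum T g n (T x) / n) atTop
      ≤ limsup (fun n : ℕ => birkhoffSum T g n x / n) atTop := by
  have hb := fun x n => div_nat_bounds n hC0 (birkhoffSum_bounds T g C h0 hC n x)
  obtain ⟨b1, b2, b3, b4⟩ := limsup_bounds (fun n => (hb x n).1) (fun n => (hb x n).2)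
  obtain ⟨c1, c2, c3, c4⟩ := limsup_bounds (fun n => (hb (T x) n).1) (fun n => (hb (T x) n).2)
  refine le_of_forall_pos_le_add fun ε hε => ?_
  set G := limsup (fun n : ℕ => birkhoffSum T g n x / n) atTop
  have h1 : ∀ᶠ n : ℕ in atTop, birkhoffSum T g n x / n < G + ε / 2 :=
    eventually_lt_of_limsup_lt (by linarith) b1
  have h2 := (tendsto_add_atTop_nat 1).eventually h1
  have h3 : ∀ᶠ n : ℕ in atTop, C / n < ε / 2 :=
    (tendsto_const_div_nat C).eventually (gt_mem_nhds (by linarith))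
  refine limsup_le_of_le c2 ?_
  filter_upwards [h2, h3, eventually_gt_atTop 0] with n h2 h3 hn
  have hn' : (0 : ℝ) < n := by exact_mod_cast hn
  have e := birkhoffSum_succ' T g n x
  have e2 := (birkhoffSum_bounds T g C h0 hC (n + 1) x).2
  have e3 := (hb x (n + 1)).2
  have e4 : birkhoffSum T g n (T x) ≤ birkhoffSum T g (n + 1) x := by
    rw [e]; linarith [h0 x]
  push_cast at h2 e3
  set S := birkhoffSum T g (n + 1) x
  have e5 : S / n = S / (n + 1) + (S / (n + 1)) / n := by field_simp
  calc birkhoffSum T g n (T x) / n ≤ S / n := by gcongr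
    _ = S / (n + 1) + (S / (n + 1)) / n := e5
    _ ≤ S / (n + 1) + C / n := by gcongr
    _ ≤ G + ε := by linarith

lemma birkhoff_measurable (T : Ω → Ω) (hT : Measurable T) (g : Ω → ℝ) (hg : Measurable g) (n : ℕ) :
    Measurable (birkhoffSum T g n) := by
  unfold birkhoffSum
  exact Finset.measurable_sum _ fun i _ => hg.comp (hT.iterate i)

/-- The upper half of Birkhoff's theorem, integrated. -/
lemma birkhoff_limsup (μ : Measure Ω) [IsProbabilityMeasure μ] (T : Ω → Ω)
    (hT : MeasurePreserving T μ μ) (g : Ω → ℝ) (hg : Measurable g) (C : ℝ) (hC0 : 0 ≤ C)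
    (h0 : ∀ x, 0 ≤ g x) (hC : ∀ x, g x ≤ C) :
    ∫ x, limsup (fun n : ℕ => birkhoffSum T g n x / n) atTop ∂μ ≤ ∫ x, g x ∂μ := by
  have hb := fun x n => div_nat_bounds n hC0 (birkhoffSum_bounds T g C h0 hC n x)
  set G : Ω → ℝ := fun x => limsup (fun n : ℕ => birkhoffSum T g n x / n) atTop with hG
  have hGb : ∀ x, 0 ≤ G x ∧ G x ≤ C := fun x => by
    obtain ⟨b1, b2, b3, b4⟩ := limsup_bounds (fun n => (hb x n).1) (fun n => (hb x n).2)
    exact ⟨b3, b4⟩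
  have hGm : Measurable G :=
    Measurable.limsup fun n => (birkhoff_measurable T hT.measurable g hg n).div_const _
  have hGi : Integrable G μ := integrable_of_bdd μ G hGm C fun x => by
    rw [abs_of_nonneg (hGb x).1]; exact (hGb x).2
  have hgi : Integrable g μ := integrable_of_bdd μ g hg C fun x => by
    rw [abs_of_nonneg (h0 x)]; exact hC x
  refine le_of_forall_pos_le_add fun ε hε => ?_
  have key := max_ergodic μ T hT (fun x => g x - G x + ε) ((hg.sub hGm).add_const ε)
    (C + ε) (fun x => by
      have := hGb x; have := h0 x; have := hC x
      rw [abs_le]; constructor <;> linarith) ?_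
  · have e1 : ∫ x, (g x - G x + ε) ∂μ = ∫ x, (g x - G x) ∂μ + ∫ x, ε ∂μ :=
      integral_add (hgi.sub hGi) (integrable_const ε)
    have e2 : ∫ x, (g x - G x) ∂μ = ∫ x, g x ∂μ - ∫ x, G x ∂μ := integral_sub hgi hGi
    have e3 : ∫ x, ε ∂μ = ε := by simp
    rw [e1, e2, e3] at key
    linarith
  · intro x
    obtain ⟨b1, b2, b3, b4⟩ := limsup_bounds (fun n => (hb x n).1) (fun n => (hb x n).2)
    have hf : ∃ᶠ n : ℕ in atTop, G x - ε < birkhoffSum T g n x / n :=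
      frequently_lt_of_lt_limsup b2 (by change G x - ε < G x; linarith)
    obtain ⟨n, hn1, hn2⟩ := (hf.and_eventually (eventually_gt_atTop 0)).exists
    refine ⟨n, ?_⟩
    have hn' : (0 : ℝ) < n := by exact_mod_cast hn2
    rw [lt_div_iff₀ hn'] at hn1
    have hGT : ∀ i, G (T^[i] x) ≤ G x := by
      intro i
      induction i with
      | zero => exact le_rfl
      | succ i ih =>
        rw [Function.iterate_succ_apply']
        exact (limsup_birkhoff_shift T g C hC0 h0 hC _).trans ih
    have : birkhoffSum T g n x - n * G x + n * ε
        ≤ birkhoffSum T (fun x => g x - G x + ε) n x := by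
      unfold birkhoffSum
      rw [Finset.sum_add_distrib, Finset.sum_sub_distrib]
      have h5 : ∑ i ∈ Finset.range n, G (T^[i] x) ≤ n * G x := by
        calc _ ≤ ∑ i ∈ Finset.range n, G x := Finset.sum_le_sum fun i _ => hGT i
          _ = _ := by simp
      simp only [Finset.sum_const, Finset.card_range, nsmul_eq_mul]
      linarith
    nlinarith

/-- The upper half of Kingman's theorem, integrated. -/
lemma kingman_limsup (μ : Measure Ω) [IsProbabilityMeasure μ] (T : Ω → Ω)
    (hT : MeasurePreserving T μ μ) (f : ℕ → Ω → ℝ) (hf : ∀ n, Measurable (f n)) (C : ℝ)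
    (hC0 : 0 ≤ C) (h0 : ∀ n x, 0 ≤ f n x) (hC : ∀ n x, f n x ≤ n * C)
    (hsub : ∀ n m x, f (n + m) x ≤ f n x + f m (T^[n] x)) (q : ℕ) (hq : 0 < q) :
    ∫ x, limsup (fun n : ℕ => f n x / n) atTop ∂μ ≤ ∫ x, f q x / q ∂μ := by
  have hq' : (0 : ℝ) < q := by exact_mod_cast hq
  have g0 : ∀ x, 0 ≤ f q x / q := fun x => div_nonneg (h0 _ _) hq'.le
  have gC : ∀ x, f q x / q ≤ C := fun x => (div_nat_bounds q hC0 ⟨h0 q x, hC q x⟩).2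
  have gm : Measurable fun x => f q x / q := (hf q).div_const _
  refine le_trans ?_ (birkhoff_limsup μ T hT (fun x => f q x / q) gm C hC0 g0 gC)
  have hb := fun x n => div_nat_bounds n hC0 (birkhoffSum_bounds T (fun x => f q x / q) C g0 gC n x)
  have hb' := fun x n => div_nat_bounds n hC0 ⟨h0 n x, hC n x⟩
  have key : ∀ x, limsup (fun n : ℕ => f n x / n) atTop
      ≤ limsup (fun n : ℕ => birkhoffSum T (fun x => f q x / q) n x / n) atTop := by
    intro x
    obtain ⟨b1, b2, b3, b4⟩ := limsup_bounds (fun n => (hb x n).1) (fun n => (hb x n).2)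
    obtain ⟨c1, c2, c3, c4⟩ := limsup_bounds (fun n => (hb' x n).1) (fun n => (hb' x n).2)
    refine le_of_forall_pos_le_add fun ε hε => ?_
    set G := limsup (fun n : ℕ => birkhoffSum T (fun x => f q x / q) n x / n) atTop
    have h1 : ∀ᶠ n : ℕ in atTop, birkhoffSum T (fun x => f q x / q) n x / n < G + ε / 2 :=
      eventually_lt_of_limsup_lt (by linarith) b1
    have h3 : ∀ᶠ n : ℕ in atTop, (2 * q * C) / n < ε / 2 :=
      (tendsto_const_div_nat _).eventually (gt_mem_nhds (by linarith))
    refine limsup_le_of_le c2 ?_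
    filter_upwards [h1, h3, eventually_ge_atTop q] with n h1 h3 hn
    have hn' : (0 : ℝ) < n := by exact_mod_cast hq.trans_le hn
    obtain ⟨N, rfl⟩ : ∃ N, n = N + q := ⟨n - q, by omega⟩
    have e := subadd_array (fun i l => f l (T^[i] x)) C hC0 (fun i l => h0 _ _)
      (fun i l => hC _ _) (fun i l l' => by
        have := hsub l l' (T^[i] x)
        rwa [← Function.iterate_add_apply, add_comm l i] at this) q N
    simp only [Function.iterate_zero, id_eq] at e
    have e1 : birkhoffSum T (fun x => f q x / q) (N + q) x
        = (∑ i ∈ Finset.range (N + q), f q (T^[i] x)) / q := by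
      unfold birkhoffSum; rw [Finset.sum_div]
    rw [e1] at h1
    set S := ∑ i ∈ Finset.range (N + q), f q (T^[i] x)
    have e2 : f (N + q) x ≤ S / q + 2 * q * C := by
      rw [← sub_nonneg]
      have : S / q + 2 * q * C - f (N + q) x = (S + 2 * (q : ℝ) ^ 2 * C - q * f (N + q) x) / q := by
        field_simp
      rw [this]
      exact div_nonneg (by linarith) hq'.le
    calc f (N + q) x / ((N + q : ℕ) : ℝ) ≤ (S / q + 2 * q * C) / ((N + q : ℕ) : ℝ) := by gcongr
      _ = S / q / ((N + q : ℕ) : ℝ) + 2 * q * C / ((N + q : ℕ) : ℝ) := by rw [add_div]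
      _ ≤ G + ε := by linarith
  refine integral_mono ?_ ?_ key
  · refine integrable_of_bdd μ _ (Measurable.limsup fun n => (hf n).div_const _) C fun x => ?_
    obtain ⟨c1, c2, c3, c4⟩ := limsup_bounds (fun n => (hb' x n).1) (fun n => (hb' x n).2)
    rw [abs_of_nonneg c3]; exact c4
  · refine integrable_of_bdd μ _ (Measurable.limsup fun n =>
      (birkhoff_measurable T hT.measurable _ gm n).div_const _) C fun x => ?_
    obtain ⟨c1, c2, c3, c4⟩ := limsup_bounds (fun n => (hb x n).1) (fun n => (hb x n).2)
    rw [abs_of_nonneg c3]; exact c4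

/-- A reverse Fatou lemma. -/
lemma rev_fatou (μ : Measure Ω) [IsProbabilityMeasure μ] (u : ℕ → Ω → ℝ)
    (hu : ∀ n, Measurable (u n)) (C : ℝ) (h0 : ∀ n x, 0 ≤ u n x) (hC : ∀ n x, u n x ≤ C)
    (c K : ℝ) (k : ℕ → ℝ) (hk : Tendsto k atTop (𝓝 K))
    (hc : ∀ n, 0 < n → c ≤ k n + ∫ x, u n x ∂μ) :
    c ≤ K + ∫ x, limsup (fun n => u n x) atTop ∂μ := by
  set G : Ω → ℝ := fun x => limsup (fun n => u n x) atTop with hG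
  have hGm : Measurable G := Measurable.limsup hu
  have hGb : ∀ x, 0 ≤ G x ∧ G x ≤ C := fun x => by
    obtain ⟨b1, b2, b3, b4⟩ := limsup_bounds (fun n => h0 n x) (fun n => hC n x)
    exact ⟨b3, b4⟩
  have hGi : Integrable G μ := integrable_of_bdd μ G hGm C fun x => by
    rw [abs_of_nonneg (hGb x).1]; exact (hGb x).2
  have hui : ∀ n, Integrable (u n) μ := fun n => integrable_of_bdd μ _ (hu n) C fun x => by
    rw [abs_of_nonneg (h0 n x)]; exact hC n x
  set w : ℕ → Ω → ℝ := fun n x => max (u n x - G x) 0 with hw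
  have hwm : ∀ n, Measurable (w n) := fun n => ((hu n).sub hGm).max measurable_const
  have hwb : ∀ n x, |w n x| ≤ C := fun n x => by
    have := hGb x; have := h0 n x; have := hC n x
    rw [abs_of_nonneg (le_max_right _ _)]
    exact max_le (by linarith) (by linarith)
  have hwi : ∀ n, Integrable (w n) μ := fun n => integrable_of_bdd μ _ (hwm n) C (hwb n)
  have hw0 : Tendsto (fun n => ∫ x, w n x ∂μ) atTop (𝓝 (∫ x, (0 : ℝ) ∂μ)) := by
    refine tendsto_integral_of_dominated_convergence (fun _ => C)
      (fun n => (hwm n).aestronglyMeasurable) (integrable_const C)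
      (fun n => ae_of_all _ (hwb n)) (ae_of_all _ fun x => ?_)
    obtain ⟨b1, b2, b3, b4⟩ := limsup_bounds (fun n => h0 n x) (fun n => hC n x)
    rw [Metric.tendsto_nhds]
    intro ε hε
    have h1 : ∀ᶠ n : ℕ in atTop, u n x < G x + ε :=
      eventually_lt_of_limsup_lt (by change G x < _; linarith) b1
    filter_upwards [h1] with n hn
    rw [Real.dist_eq, sub_zero, abs_of_nonneg (le_max_right _ _)]
    exact max_lt (by linarith) hε
  rw [integral_zero] at hw0
  have hlim : Tendsto (fun n => k n + (∫ x, G x ∂μ + ∫ x, w n x ∂μ)) atTop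
      (𝓝 (K + (∫ x, G x ∂μ + 0))) := hk.add (tendsto_const_nhds.add hw0)
  rw [add_zero] at hlim
  refine ge_of_tendsto hlim ?_
  filter_upwards [eventually_gt_atTop 0] with n hn
  refine (hc n hn).trans ?_
  have : ∫ x, u n x ∂μ ≤ ∫ x, G x ∂μ + ∫ x, w n x ∂μ := by
    rw [← integral_add hGi (hwi n)]
    refine integral_mono (hui n) (hGi.add (hwi n)) fun x => ?_
    have := le_max_left (u n x - G x) 0
    simp only [hw]
    linarith
  linarith

end ErgodicLemmas

section Blocks

variable {A B : Type*}
  [Fintype A] [TopologicalSpace A] [DiscreteTopology A]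
  [MeasurableSpace A] [MeasurableSingletonClass A]
  [Fintype B] [TopologicalSpace B] [DiscreteTopology B]
  [MeasurableSpace B] [MeasurableSingletonClass B]

lemma real_marg {Ω U S : Type*} [MeasurableSpace Ω] [Fintype U] [MeasurableSpace U]
    [MeasurableSingletonClass U] (μ : Measure Ω) [IsFiniteMeasure μ] (h : Ω → U)
    (hh : Measurable h) (u : U → S) (s : S) :
    μ.real ((fun x => u (h x)) ⁻¹' {s}) = ∑ w, if u w = s then μ.real (h ⁻¹' {w}) else 0 := by
  have e : (fun x => u (h x)) ⁻¹' {s} = ⋃ w ∈ Finset.univ.filter (fun w => u w = s), h ⁻¹' {w} := by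
    ext x; simp
  rw [e, measureReal_biUnion_finset, Finset.sum_filter]
  · intro a _ b _ hab
    exact Disjoint.preimage h (by simpa using hab)
  · intro w _
    exact hh (measurableSet_singleton w)

lemma integral_fin {Ω U : Type*} [MeasurableSpace Ω] [Fintype U] [MeasurableSpace U]
    [MeasurableSingletonClass U] (μ : Measure Ω) [IsFiniteMeasure μ] (h : Ω → U)
    (hh : Measurable h) (g : U → ℝ) :
    ∫ x, g (h x) ∂μ = ∑ w, μ.real (h ⁻¹' {w}) * g w := by
  rw [← integral_map (φ := h) (f := g) hh.aemeasurable
    (measurable_of_finite g).aestronglyMeasurable]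
  rw [integral_fintype Integrable.of_finite]
  refine Finset.sum_congr rfl fun w _ => ?_
  rw [map_measureReal_apply hh (measurableSet_singleton w), smul_eq_mul]

lemma real_total {Ω U : Type*} [MeasurableSpace Ω] [Fintype U] [MeasurableSpace U]
    [MeasurableSingletonClass U] (μ : Measure Ω) [IsProbabilityMeasure μ] (h : Ω → U)
    (hh : Measurable h) : ∑ w, μ.real (h ⁻¹' {w}) = 1 := by
  have := integral_fin μ h hh (fun _ => 1)
  simpa using this.symm

/-- The block of length `l` starting at position `i`. -/
def blk (X : Subshift A) (i l : ℕ) : X.pt → (Fin l → A) := fun x j => x.1 (i + j)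

lemma blk_continuous (X : Subshift A) (i l : ℕ) : Continuous (blk X i l) := by
  unfold blk
  exact continuous_pi fun j => (continuous_apply _).comp continuous_subtype_val

lemma blk_measurable (X : Subshift A) (i l : ℕ) : Measurable (blk X i l) := by
  unfold blk
  exact measurable_pi_lambda _ fun j => (measurable_pi_apply _).comp measurable_subtype_coe

lemma sig_continuous (X : Subshift A) : Continuous X.σ := by
  unfold Subshift.σ shiftF
  refine Continuous.subtype_mk ?_ _
  exact continuous_pi fun j => (continuous_apply _).comp continuous_subtype_val

lemma sig_measurable (X : Subshift A) : Measurable X.σ := (sig_continuous X).measurable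

lemma sig_iter (X : Subshift A) (i j : ℕ) (x : X.pt) : (X.σ^[i] x).1 j = x.1 (i + j) := by
  induction i generalizing x with
  | zero => simp
  | succ i ih =>
    rw [Function.iterate_succ_apply, ih]
    change x.1 (i + j + 1) = _
    have e : i + j + 1 = i + 1 + j := by omega
    rw [e]

lemma blk_sig (X : Subshift A) (k i l : ℕ) (x : X.pt) :
    blk X i l (X.σ^[k] x) = blk X (k + i) l x := by
  funext j
  simp only [blk, sig_iter, add_assoc]

noncomputable def bp (X : Subshift A) (μ : Measure X.pt) (i l : ℕ) (w : Fin l → A) : ℝ :=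
  μ.real (blk X i l ⁻¹' {w})

noncomputable def bH (X : Subshift A) (μ : Measure X.pt) (i l : ℕ) : ℝ :=
  ∑ w, Real.negMulLog (bp X μ i l w)

lemma bp_nonneg (X : Subshift A) (μ : Measure X.pt) (i l : ℕ) (w : Fin l → A) :
    0 ≤ bp X μ i l w := measureReal_nonneg

lemma bp_sum (X : Subshift A) (μ : Measure X.pt) [IsProbabilityMeasure μ] (i l : ℕ) :
    ∑ w, bp X μ i l w = 1 := real_total μ _ (blk_measurable X i l)

lemma cyl_eq (X : Subshift A) {n : ℕ} (w : Fin n → A) : cyl X w = blk X 0 n ⁻¹' {w} := by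
  ext x
  simp only [cyl, blk, mem_ofPred_eq, mem_preimage, mem_singleton_iff, funext_iff, zero_add]

lemma blockH_eq (X : Subshift A) (μ : ProbabilityMeasure X.pt) (n : ℕ) :
    blockH X μ n = bH X μ.toMeasure 0 n := by
  unfold blockH bH bp
  simp_rw [cyl_eq]
  rfl

lemma bH_nonneg (X : Subshift A) (μ : Measure X.pt) [IsProbabilityMeasure μ] (i l : ℕ) :
    0 ≤ bH X μ i l :=
  Finset.sum_nonneg fun w _ => Real.negMulLog_nonneg (bp_nonneg X μ i l w) measureReal_le_one

lemma bH_le (X : Subshift A) (μ : Measure X.pt) [IsProbabilityMeasure μ] (i l : ℕ) :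
    bH X μ i l ≤ l * Real.log (Fintype.card A) := by
  refine (ent_card _ (bp_nonneg X μ i l) (bp_sum X μ i l)).trans (le_of_eq ?_)
  rw [Fintype.card_fun, Fintype.card_fin, Nat.cast_pow, Real.log_pow]

lemma bH_sub (X : Subshift A) (μ : Measure X.pt) [IsProbabilityMeasure μ] (i l l' : ℕ) :
    bH X μ i (l + l') ≤ bH X μ i l + bH X μ (i + l) l' := by
  refine ent_pair (bp X μ i (l + l')) (bp_nonneg X μ _ _) (bp_sum X μ _ _)
    (fun w j => w (Fin.castAdd l' j)) (fun w j => w (Fin.natAdd l j)) ?_ _ _ ?_ ?_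
  · intro w w' h
    simp only [Prod.mk.injEq, funext_iff] at h
    funext j
    exact Fin.addCases (fun j => h.1 j) (fun j => h.2 j) j
  · intro s
    exact real_marg μ (blk X i (l + l')) (blk_measurable X _ _)
      (fun w j => w (Fin.castAdd l' j)) s
  · intro s
    have := real_marg μ (blk X i (l + l')) (blk_measurable X _ _)
      (fun w j => w (Fin.natAdd l j)) s
    unfold bp
    rw [← this]
    congr 2
    funext x j
    simp [blk, add_assoc]

lemma inv_mp (X : Subshift A) (μ : ProbabilityMeasure X.pt) (h : μ ∈ invP X) :
    MeasurePreserving X.σ μ.toMeasure μ.toMeasure := ⟨sig_measurable X, h⟩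

lemma bp_inv (X : Subshift A) (μ : ProbabilityMeasure X.pt) (h : μ ∈ invP X) (i l : ℕ)
    (w : Fin l → A) : bp X μ.toMeasure i l w = bp X μ.toMeasure 0 l w := by
  have h1 := ((inv_mp X μ h).iterate i).measureReal_preimage
    (s := blk X 0 l ⁻¹' {w}) (blk_measurable X 0 l (measurableSet_singleton w)).nullMeasurableSet
  unfold bp
  rw [← h1, ← preimage_comp]
  congr 2
  funext x
  exact (blk_sig X i 0 l x).symm

lemma KS_bdd (X : Subshift A) (μ : ProbabilityMeasure X.pt) :
    BddBelow (range fun n : ℕ => blockH X μ (n + 1) / ((n : ℝ) + 1)) := by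
  refine ⟨0, ?_⟩
  rintro _ ⟨n, rfl⟩
  dsimp only
  rw [blockH_eq]
  exact div_nonneg (bH_nonneg _ _ _ _) (by positivity)

lemma KS_le (X : Subshift A) (μ : ProbabilityMeasure X.pt) (n : ℕ) (hn : 0 < n) :
    KS X μ ≤ bH X μ.toMeasure 0 n / n := by
  have := ciInf_le (KS_bdd X μ) (n - 1)
  rw [blockH_eq] at this
  obtain ⟨k, rfl⟩ : ∃ k, n = k + 1 := ⟨n - 1, by omega⟩
  refine le_trans this (le_of_eq ?_)
  simp

lemma KS_tendsto (X : Subshift A) (μ : ProbabilityMeasure X.pt) (h : μ ∈ invP X) :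
    Tendsto (fun n : ℕ => bH X μ.toMeasure 0 n / n) atTop (𝓝 (KS X μ)) := by
  have hs : Subadditive (fun n => bH X μ.toMeasure 0 n) := by
    intro m n
    refine (bH_sub X μ.toMeasure 0 m n).trans (le_of_eq ?_)
    congr 1
    unfold bH
    simp_rw [bp_inv X μ h]
  have hbdd : BddBelow (range fun n : ℕ => bH X μ.toMeasure 0 n / n) := by
    refine ⟨0, ?_⟩
    rintro _ ⟨n, rfl⟩
    exact div_nonneg (bH_nonneg _ _ _ _) (Nat.cast_nonneg _)
  have ht := hs.tendsto_lim hbdd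
  have : KS X μ = hs.lim := by
    refine le_antisymm ?_ ?_
    · refine ge_of_tendsto ht ?_
      filter_upwards [eventually_gt_atTop 0] with n hn using KS_le X μ n hn
    · refine le_ciInf fun n => ?_
      rw [blockH_eq]
      have := hs.lim_le_div hbdd (n := n + 1) (by omega)
      simpa using this
  rw [this]
  exact ht

variable {X : Subshift A} {Y : Subshift B}

/-- `log |π⁻¹[y₁⋯yₙ]|`. -/
noncomputable def lcnt (π : Factor X Y) (n : ℕ) (y : Y.pt) : ℝ :=
  Real.log (preCnt π (fun i : Fin n => y.1 (i : ℕ)))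

lemma lcnt_eq (π : Factor X Y) (n : ℕ) (y : Y.pt) :
    lcnt π n y = Real.log (preCnt π (blk Y 0 n y)) := by
  unfold lcnt blk
  simp

lemma lcnt_measurable (π : Factor X Y) (n : ℕ) : Measurable (lcnt π n) := by
  have : lcnt π n = (fun v : Fin n → B => Real.log (preCnt π v)) ∘ blk Y 0 n := by
    funext y; exact lcnt_eq π n y
  rw [this]
  exact (measurable_of_finite _).comp (blk_measurable Y 0 n)

lemma preCnt_pos (π : Factor X Y) (n i : ℕ) (y : Y.pt) : 0 < preCnt π (blk Y i n y) := by
  obtain ⟨x, hx, hxy⟩ := π.surj y.1 y.2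
  have : Nonempty {w : Fin n → A // allowW X w ∧ ∀ j, π.symb (w j) = blk Y i n y j} := by
    refine ⟨⟨blk X i n ⟨x, hx⟩, ⟨(X.σ^[i] ⟨x, hx⟩).1, (X.σ^[i] ⟨x, hx⟩).2, fun j => ?_⟩,
      fun j => ?_⟩⟩
    · rw [sig_iter]; rfl
    · exact congrFun hxy (i + j)
  exact Nat.card_pos

lemma lcnt_nonneg (π : Factor X Y) (n : ℕ) (y : Y.pt) : 0 ≤ lcnt π n y := by
  rw [lcnt_eq]
  exact Real.log_natCast_nonneg _

lemma lcnt_le (π : Factor X Y) (n : ℕ) (y : Y.pt) :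
    lcnt π n y ≤ n * Real.log (Fintype.card A) := by
  rw [lcnt_eq, ← Real.log_pow]
  have h := preCnt_pos π n 0 y
  refine Real.log_le_log (by exact_mod_cast h) ?_
  have : preCnt π (blk Y 0 n y) ≤ Nat.card (Fin n → A) :=
    Nat.card_le_card_of_injective Subtype.val Subtype.val_injective
  rw [Nat.card_eq_fintype_card, Fintype.card_fun, Fintype.card_fin] at this
  exact_mod_cast this

lemma lcnt_sub (π : Factor X Y) (n m : ℕ) (y : Y.pt) :
    lcnt π (n + m) y ≤ lcnt π n y + lcnt π m (Y.σ^[n] y) := by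
  rw [lcnt_eq, lcnt_eq, lcnt_eq, blk_sig]
  have h1 := preCnt_pos π n 0 y
  have h2 := preCnt_pos π m n y
  have h3 := preCnt_pos π (n + m) 0 y
  rw [add_zero]
  rw [← Real.log_mul (by exact_mod_cast h1.ne') (by exact_mod_cast h2.ne')]
  refine Real.log_le_log (by exact_mod_cast h3) ?_
  have : preCnt π (blk Y 0 (n + m) y) ≤ preCnt π (blk Y 0 n y) * preCnt π (blk Y n m y) := by
    unfold preCnt
    rw [← Nat.card_prod]
    refine Nat.card_le_card_of_injective
      (fun w => (⟨fun j => w.1 (Fin.castAdd m j), ?_, ?_⟩, ⟨fun j => w.1 (Fin.natAdd n j), ?_, ?_⟩))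
      ?_
    · obtain ⟨x, hx, hw⟩ := w.2.1
      exact ⟨x, hx, fun i => hw (Fin.castAdd m i)⟩
    · intro i
      exact w.2.2 (Fin.castAdd m i)
    · obtain ⟨x, hx, hw⟩ := w.2.1
      refine ⟨(X.σ^[n] ⟨x, hx⟩).1, (X.σ^[n] ⟨x, hx⟩).2, fun i => ?_⟩
      rw [sig_iter]
      exact hw (Fin.natAdd n i)
    · intro i
      have := w.2.2 (Fin.natAdd n i)
      simpa [blk] using this
    · intro w w' h
      simp only [Prod.mk.injEq, Subtype.mk.injEq, funext_iff] at h
      apply Subtype.ext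
      funext j
      exact Fin.addCases (fun j => h.1 j) (fun j => h.2 j) j
  exact_mod_cast this

lemma relP'_eq (π : Factor X Y) (y : Y.pt) :
    relP' π y = limsup (fun n : ℕ => lcnt π n y / n) atTop := rfl

lemma logA_nonneg (A : Type*) [Fintype A] : 0 ≤ Real.log (Fintype.card A) :=
  Real.log_natCast_nonneg _

lemma lcnt_div (π : Factor X Y) (n : ℕ) (y : Y.pt) :
    0 ≤ lcnt π n y / n ∧ lcnt π n y / n ≤ Real.log (Fintype.card A) :=
  div_nat_bounds n (logA_nonneg A) ⟨lcnt_nonneg π n y, lcnt_le π n y⟩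

lemma relP'_abs (π : Factor X Y) (y : Y.pt) : |relP' π y| ≤ Real.log (Fintype.card A) := by
  obtain ⟨c1, c2, c3, c4⟩ := limsup_bounds (fun n => (lcnt_div π n y).1)
    (fun n => (lcnt_div π n y).2)
  rw [relP'_eq, abs_of_nonneg c3]
  exact c4

lemma relP'_measurable (π : Factor X Y) : Measurable (relP' π) :=
  Measurable.limsup fun n => (lcnt_measurable π n).div_const _

lemma lcnt_integral (π : Factor X Y) (m : ProbabilityMeasure Y.pt) (n : ℕ) :
    ∫ y, lcnt π n y ∂m.toMeasure
      = ∑ v, bp Y m.toMeasure 0 n v * Real.log (preCnt π v) := by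
  simp_rw [lcnt_eq]
  exact integral_fin m.toMeasure (blk Y 0 n) (blk_measurable Y 0 n)
    (fun v => Real.log (preCnt π v))

lemma preCnt_card (π : Factor X Y) {n : ℕ} (v : Fin n → B) :
    preCnt π v = Nat.card {w : Fin n → A // allowW X w ∧ (fun i => π.symb (w i)) = v} := by
  unfold preCnt
  simp only [funext_iff]

lemma blk_pi (π : Factor X Y) (i l : ℕ) (x : X.pt) :
    blk Y i l (π.map x) = fun j => π.symb (blk X i l x j) := rfl

lemma bp_push (π : Factor X Y) (μ : Measure X.pt) [IsFiniteMeasure μ] (i l : ℕ) (v : Fin l → B) :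
    bp Y (μ.map π.map) i l v
      = ∑ w, if (fun j => π.symb (w j)) = v then bp X μ i l w else 0 := by
  unfold bp
  rw [map_measureReal_apply π.measurable_map (blk_measurable Y i l (measurableSet_singleton v))]
  convert real_marg μ (blk X i l) (blk_measurable X i l) (fun w j => π.symb (w j)) v using 1
  · rfl
  · exact Finset.sum_congr rfl fun w _ => by congr

lemma push_inv (π : Factor X Y) (μ : ProbabilityMeasure X.pt) (h : μ ∈ invP X) :
    π.push μ ∈ invP Y := by
  change (μ.toMeasure.map π.map).map Y.σ = μ.toMeasure.map π.map
  rw [Measure.map_map (sig_measurable Y) π.measurable_map]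
  have : Y.σ ∘ π.map = π.map ∘ X.σ := rfl
  rw [this, ← Measure.map_map π.measurable_map (sig_measurable X), h]

lemma bH_fiber (π : Factor X Y) (μ : ProbabilityMeasure X.pt) (n : ℕ) :
    bH X μ.toMeasure 0 n ≤ bH Y (π.push μ).toMeasure 0 n
      + ∫ y, lcnt π n y ∂(π.push μ).toMeasure := by
  rw [lcnt_integral]
  simp_rw [preCnt_card]
  refine ent_fiber _ (bp_nonneg _ _ _ _) (bp_sum _ _ _ _) (fun w j => π.symb (w j))
    (fun w => allowW X w) ?_ _ (fun v => by
      refine (bp_push π μ.toMeasure 0 n v).trans ?_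
      exact Finset.sum_congr rfl fun w _ => by congr)
  intro w hw
  by_contra hna
  apply hw
  have : blk X 0 n ⁻¹' {w} = ∅ := by
    rw [eq_empty_iff_forall_notMem]
    intro x hx
    refine hna ⟨x.1, x.2, fun i => ?_⟩
    have := congrFun hx i
    simpa [blk] using this
  simp [bp, this]

/-- Upper bound for the entropy of a measure over its image. -/
lemma KS_upper (π : Factor X Y) (μ : ProbabilityMeasure X.pt) (h : μ ∈ invP X) :
    KS X μ ≤ KS Y (π.push μ) + ∫ y, relP' π y ∂(π.push μ).toMeasure := by
  refine rev_fatou (π.push μ).toMeasure (fun n y => lcnt π n y / n)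
    (fun n => (lcnt_measurable π n).div_const _) (Real.log (Fintype.card A))
    (fun n y => (lcnt_div π n y).1) (fun n y => (lcnt_div π n y).2) _ _ _
    (KS_tendsto Y _ (push_inv π μ h)) fun n hn => ?_
  have hn' : (0 : ℝ) < n := by exact_mod_cast hn
  rw [integral_div, ← add_div]
  refine (KS_le X μ n hn).trans ?_
  exact div_le_div_of_nonneg_right (bH_fiber π μ n) hn'.le

lemma relP'_le (π : Factor X Y) (m : ProbabilityMeasure Y.pt) (h : m ∈ invP Y) (n : ℕ)
    (hn : 0 < n) : n * ∫ y, relP' π y ∂m.toMeasure ≤ ∫ y, lcnt π n y ∂m.toMeasure := by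
  have hn' : (0 : ℝ) < n := by exact_mod_cast hn
  have := kingman_limsup m.toMeasure Y.σ (inv_mp Y m h) (lcnt π) (lcnt_measurable π)
    (Real.log (Fintype.card A)) (logA_nonneg A) (lcnt_nonneg π) (lcnt_le π) (lcnt_sub π) n hn
  rw [integral_div, le_div_iff₀ hn'] at this
  rw [mul_comm]
  exact this

end Blocks

section Lower

variable {A B : Type*}
  [Fintype A] [TopologicalSpace A] [DiscreteTopology A]
  [MeasurableSpace A] [MeasurableSingletonClass A]
  [Fintype B] [TopologicalSpace B] [DiscreteTopology B]
  [MeasurableSpace B] [MeasurableSingletonClass B]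

lemma measure_ext_bp (X : Subshift A) (μ ν : Measure X.pt) [IsFiniteMeasure μ] [IsFiniteMeasure ν]
    (h : ∀ q w, bp X μ 0 q w = bp X ν 0 q w) : μ = ν := by
  have hblk : ∀ q, μ.map (blk X 0 q) = ν.map (blk X 0 q) := by
    intro q
    refine Measure.ext_of_singleton fun w => ?_
    rw [Measure.map_apply (blk_measurable X 0 q) (measurableSet_singleton w),
      Measure.map_apply (blk_measurable X 0 q) (measurableSet_singleton w)]
    have := h q w
    unfold bp at this
    rwa [measureReal_eq_measureReal_iff] at this
  have hval : μ.map (Subtype.val : X.pt → ℕ → A) = ν.map (Subtype.val : X.pt → ℕ → A) := by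
    refine IsProjectiveLimit.unique (α := fun _ : ℕ => A)
      (P := fun I => (ν.map (Subtype.val : X.pt → ℕ → A)).map I.restrict) ?_ (fun I => rfl)
    intro I
    have hI : ∀ j : I, (j : ℕ) < I.sup id + 1 := fun j =>
      Nat.lt_succ_of_le (Finset.le_sup (f := id) j.2)
    beta_reduce
    rw [Measure.map_map (Finset.measurable_restrict I) measurable_subtype_coe,
      Measure.map_map (Finset.measurable_restrict I) measurable_subtype_coe]
    have e : (I.restrict ∘ (Subtype.val : X.pt → ℕ → A))
        = (fun (w : Fin (I.sup id + 1) → A) (j : I) => w ⟨j, hI j⟩) ∘ blk X 0 (I.sup id + 1) := by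
      funext x j
      simp [blk]
    rw [e, ← Measure.map_map (measurable_of_finite _) (blk_measurable X 0 _),
      ← Measure.map_map (measurable_of_finite _) (blk_measurable X 0 _), hblk]
  have hemb : MeasurableEmbedding (Subtype.val : X.pt → ℕ → A) :=
    MeasurableEmbedding.subtype_coe X.isClosed.measurableSet
  rw [← hemb.comap_map μ, ← hemb.comap_map ν, hval]

lemma exists_fin_measure (X : Subshift A) (n : ℕ) (hX : Nonempty X.pt) (c : (Fin n → A) → ℝ)
    (hc0 : ∀ w, 0 ≤ c w) (hc1 : ∑ w, c w = 1) (hc : ∀ w, c w ≠ 0 → allowW X w) :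
    ∃ ν : ProbabilityMeasure X.pt, ∀ w, bp X ν.toMeasure 0 n w = c w := by
  have hpick : ∀ w : Fin n → A, ∃ x : X.pt, c w ≠ 0 → blk X 0 n x = w := by
    intro w
    by_cases h : c w = 0
    · exact ⟨hX.some, fun h' => absurd h h'⟩
    · obtain ⟨x, hx, hw⟩ := hc w h
      refine ⟨⟨x, hx⟩, fun _ => ?_⟩
      funext j
      simpa [blk] using hw j
  choose pick hpick using hpick
  set ν : Measure X.pt := ∑ w, ENNReal.ofReal (c w) • Measure.dirac (pick w) with hν
  have hprob : IsProbabilityMeasure ν := by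
    constructor
    rw [hν, Measure.finsetSum_apply]
    simp only [Measure.smul_apply, measure_univ, smul_eq_mul, mul_one]
    rw [← ENNReal.ofReal_sum_of_nonneg (fun w _ => hc0 w), hc1, ENNReal.ofReal_one]
  refine ⟨⟨ν, hprob⟩, fun w => ?_⟩
  change ν.real (blk X 0 n ⁻¹' {w}) = c w
  have hm : MeasurableSet (blk X 0 n ⁻¹' {w}) := blk_measurable X 0 n (measurableSet_singleton w)
  have : ν (blk X 0 n ⁻¹' {w}) = ENNReal.ofReal (c w) := by
    rw [hν, Measure.finsetSum_apply, Finset.sum_eq_single w]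
    · rw [Measure.smul_apply, Measure.dirac_apply' _ hm]
      by_cases h : c w = 0
      · simp [h]
      · rw [indicator_of_mem (by exact hpick w h)]; simp
    · intro w' _ hw'
      rw [Measure.smul_apply, Measure.dirac_apply' _ hm]
      by_cases h : c w' = 0
      · simp [h]
      · rw [indicator_of_notMem]
        · simp
        · intro hmem
          exact hw' ((hpick w' h).symm.trans hmem)
    · simp
  rw [measureReal_def, this, ENNReal.toReal_ofReal (hc0 w)]

lemma exists_avg (X : Subshift A) (ν : ProbabilityMeasure X.pt) (n : ℕ) (hn : 0 < n) :
    ∃ μ : ProbabilityMeasure X.pt, ∀ S, MeasurableSet S →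
      μ.toMeasure.real S = (∑ i ∈ Finset.range n, ν.toMeasure.real (X.σ^[i] ⁻¹' S)) / n := by
  set μ : Measure X.pt := (n : ℝ≥0∞)⁻¹ • ∑ i ∈ Finset.range n, ν.toMeasure.map (X.σ^[i]) with hμ
  have hap : ∀ S, MeasurableSet S →
      μ S = (n : ℝ≥0∞)⁻¹ * ∑ i ∈ Finset.range n, ν.toMeasure (X.σ^[i] ⁻¹' S) := by
    intro S hS
    rw [hμ, Measure.smul_apply, Measure.finsetSum_apply, smul_eq_mul]
    congr 1
    exact Finset.sum_congr rfl fun i _ => Measure.map_apply ((sig_measurable X).iterate i) hS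
  have hprob : IsProbabilityMeasure μ := by
    constructor
    rw [hap _ MeasurableSet.univ]
    simp only [preimage_univ, measure_univ, Finset.sum_const, Finset.card_range, nsmul_eq_mul,
      mul_one]
    exact ENNReal.inv_mul_cancel (by exact_mod_cast hn.ne') (ENNReal.natCast_ne_top n)
  refine ⟨⟨μ, hprob⟩, fun S hS => ?_⟩
  change μ.real S = _
  rw [measureReal_def, hap S hS, ENNReal.toReal_mul, ENNReal.toReal_sum (fun i _ => measure_ne_top _ _),
    ENNReal.toReal_inv, ENNReal.toReal_natCast, div_eq_inv_mul]
  rfl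

variable {X : Subshift A} {Y : Subshift B}

lemma bp_zero_of_preCnt (π : Factor X Y) (m : Measure Y.pt) (n : ℕ) (v : Fin n → B)
    (h : preCnt π v = 0) : bp Y m 0 n v = 0 := by
  have : blk Y 0 n ⁻¹' {v} = ∅ := by
    rw [eq_empty_iff_forall_notMem]
    intro y hy
    have h1 := preCnt_pos π n 0 y
    rw [show blk Y 0 n y = v from hy, h] at h1
    exact lt_irrefl _ h1
  simp [bp, this]

lemma exists_lift (π : Factor X Y) (m : ProbabilityMeasure Y.pt) (n : ℕ) :
    ∃ ν : ProbabilityMeasure X.pt,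
      (∀ v, bp Y (ν.toMeasure.map π.map) 0 n v = bp Y m.toMeasure 0 n v) ∧
      bH X ν.toMeasure 0 n = bH Y m.toMeasure 0 n + ∫ y, lcnt π n y ∂m.toMeasure := by
  have hY : Nonempty Y.pt := nonempty_of_isProbabilityMeasure m.toMeasure
  have hX : Nonempty X.pt := by
    obtain ⟨x, hx, _⟩ := π.surj _ hY.some.2
    exact ⟨⟨x, hx⟩⟩
  set p : (Fin n → B) → ℝ := bp Y m.toMeasure 0 n with hp
  set N : (Fin n → B) → ℝ := fun v => (preCnt π v : ℝ) with hN
  have hp0 : ∀ v, 0 ≤ p v := bp_nonneg Y _ 0 n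
  have hN0 : ∀ v, 0 ≤ N v := fun v => Nat.cast_nonneg _
  have hpN : ∀ v, N v = 0 → p v = 0 := fun v hv =>
    bp_zero_of_preCnt π m.toMeasure n v ((Nat.cast_eq_zero (R := ℝ)).mp hv)
  set u : (Fin n → A) → (Fin n → B) := fun w j => π.symb (w j) with hu
  have hcf : ∀ g : (Fin n → B) → ℝ, ∑ w, (if allowW X w then g (u w) else 0)
      = ∑ v, N v * g v := by
    intro g
    rw [card_fiber_sum u (fun w => allowW X w) g]
    refine Finset.sum_congr rfl fun v _ => ?_
    simp only [hN, preCnt_card]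
    rfl
  have hNp : ∀ v, N v * (p v / N v) = p v := by
    intro v
    by_cases h : N v = 0
    · rw [h, hpN v h]; simp
    · field_simp
  obtain ⟨ν, hν⟩ := exists_fin_measure X n hX
    (fun w => if allowW X w then p (u w) / N (u w) else 0)
    (fun w => by
      split_ifs
      · exact div_nonneg (hp0 _) (hN0 _)
      · exact le_rfl)
    (by
      rw [hcf (fun v => p v / N v)]
      simp_rw [hNp]
      exact bp_sum Y _ 0 n)
    (fun w h => by
      by_contra hna
      exact h (if_neg hna))
  refine ⟨ν, ?_, ?_⟩
  · intro v
    rw [bp_push]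
    have e : ∀ w : Fin n → A, (if (fun j => π.symb (w j)) = v then bp X ν.toMeasure 0 n w else 0)
        = if allowW X w then (fun v' => if v' = v then p v' / N v' else 0) (u w) else 0 := by
      intro w
      rw [hν w]
      dsimp only
      split_ifs <;> rfl
    refine Eq.trans (Finset.sum_congr rfl fun w _ => ?_)
      ((hcf (fun v' => if v' = v then p v' / N v' else 0)).trans ?_)
    · rw [← e w]
    rw [Finset.sum_eq_single v]
    · simp [hNp]
    · intro v' _ hv'
      simp [hv']
    · simp
  · rw [lcnt_integral]
    unfold bH
    have e : ∀ w : Fin n → A, Real.negMulLog (bp X ν.toMeasure 0 n w)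
        = if allowW X w then (fun v => Real.negMulLog (p v / N v)) (u w) else 0 := by
      intro w
      rw [hν w]
      dsimp only
      split_ifs <;> simp
    rw [Finset.sum_congr rfl (fun w _ => e w), hcf (fun v => Real.negMulLog (p v / N v)),
      ← Finset.sum_add_distrib]
    refine Finset.sum_congr rfl fun v _ => ?_
    change N v * Real.negMulLog (p v / N v) = Real.negMulLog (p v) + p v * Real.log (N v)
    by_cases h : N v = 0
    · rw [h, hpN v h]; simp
    · by_cases h' : p v = 0
      · rw [h']; simp
      · unfold Real.negMulLog
        rw [Real.log_div h' h]
        field_simp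
        ring

lemma bp_eq_of_zero (Y : Subshift B) (m m' : Measure Y.pt) [IsFiniteMeasure m] [IsFiniteMeasure m']
    (n : ℕ) (h : ∀ v, bp Y m 0 n v = bp Y m' 0 n v) (i q : ℕ) (hiq : i + q ≤ n) (v : Fin q → B) :
    bp Y m i q v = bp Y m' i q v := by
  have e : blk Y i q = fun y =>
      (fun (w : Fin n → B) (j : Fin q) => w ⟨i + j, by omega⟩) (blk Y 0 n y) := by
    funext y j
    simp [blk]
  unfold bp at h ⊢
  rw [e, real_marg m (blk Y 0 n) (blk_measurable Y 0 n)
      (fun (w : Fin n → B) (j : Fin q) => w ⟨i + j, by omega⟩),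
    real_marg m' (blk Y 0 n) (blk_measurable Y 0 n)
      (fun (w : Fin n → B) (j : Fin q) => w ⟨i + j, by omega⟩)]
  refine Finset.sum_congr rfl fun w _ => ?_
  rw [h]

lemma blk_pre (X : Subshift A) (i k l : ℕ) (w : Fin l → A) :
    X.σ^[i] ⁻¹' (blk X k l ⁻¹' {w}) = blk X (i + k) l ⁻¹' {w} := by
  ext x
  simp only [mem_preimage, mem_singleton_iff, blk_sig]

lemma bp_diff_le (X : Subshift A) (μ ν : Measure X.pt) [IsProbabilityMeasure μ]
    [IsProbabilityMeasure ν] (i j l : ℕ) (w : Fin l → A) :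
    |bp X μ i l w - bp X ν j l w| ≤ 1 := by
  have h1 : bp X μ i l w ≤ 1 := measureReal_le_one
  have h2 : bp X ν j l w ≤ 1 := measureReal_le_one
  have h3 := bp_nonneg X μ i l w
  have h4 := bp_nonneg X ν j l w
  rw [abs_le]; constructor <;> linarith

lemma exists_approx (π : Factor X Y) (m : ProbabilityMeasure Y.pt) (hm : m ∈ invP Y) (n : ℕ)
    (hn : 0 < n) : ∃ μ : ProbabilityMeasure X.pt,
      (∀ q, q ≤ n → q * (bH Y m.toMeasure 0 n + ∫ y, lcnt π n y ∂m.toMeasure)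
        ≤ n * bH X μ.toMeasure 0 q + 2 * (q : ℝ) ^ 2 * Real.log (Fintype.card A)) ∧
      (∀ q w, |bp X μ.toMeasure 1 q w - bp X μ.toMeasure 0 q w| ≤ 1 / n) ∧
      (∀ q v, q ≤ n → |bp Y (μ.toMeasure.map π.map) 0 q v - bp Y m.toMeasure 0 q v| ≤ q / n) := by
  have hn' : (0 : ℝ) < n := by exact_mod_cast hn
  obtain ⟨ν, hν1, hν2⟩ := exists_lift π m n
  obtain ⟨μ, hμ⟩ := exists_avg X ν n hn
  have hbp : ∀ k q w, bp X μ.toMeasure k q w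
      = (∑ i ∈ Finset.range n, bp X ν.toMeasure (i + k) q w) / n := by
    intro k q w
    unfold bp
    rw [hμ _ (blk_measurable X k q (measurableSet_singleton w))]
    simp_rw [blk_pre]
  refine ⟨μ, ?_, ?_, ?_⟩
  · intro q hq
    obtain ⟨N, rfl⟩ : ∃ N, n = N + q := ⟨n - q, by omega⟩
    rw [← hν2]
    refine (subadd_array (bH X ν.toMeasure) (Real.log (Fintype.card A)) (logA_nonneg A)
      (bH_nonneg X _) (bH_le X _) (bH_sub X _) q N).trans ?_
    gcongr
    unfold bH
    rw [Finset.sum_comm, Finset.mul_sum]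
    refine Finset.sum_le_sum fun w _ => ?_
    rw [hbp]
    simp only [add_zero]
    have := Real.concaveOn_negMulLog.le_map_sum (t := Finset.range (N + q))
      (w := fun _ => (((N + q : ℕ) : ℝ))⁻¹) (p := fun i => bp X ν.toMeasure i q w)
      (fun _ _ => by positivity) (by
        rw [Finset.sum_const, Finset.card_range, nsmul_eq_mul, mul_inv_cancel₀ hn'.ne'])
      (fun i _ => bp_nonneg X _ _ _ _)
    simp only [smul_eq_mul] at this
    rw [← Finset.mul_sum, ← Finset.mul_sum, ← div_eq_inv_mul, ← div_eq_inv_mul,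
      div_le_iff₀ hn'] at this
    linarith
  · intro q w
    rw [hbp, hbp, ← sub_div, ← Finset.sum_sub_distrib]
    simp only [add_zero]
    rw [Finset.sum_range_sub (fun i => bp X ν.toMeasure i q w), abs_div, abs_of_pos hn']
    gcongr
    exact bp_diff_le X _ _ _ _ _ _
  · intro q v hq
    obtain ⟨N, rfl⟩ : ∃ N, n = N + q := ⟨n - q, by omega⟩
    have hpr : IsProbabilityMeasure (ν.toMeasure.map π.map) :=
      Measure.isProbabilityMeasure_map π.measurable_map.aemeasurable
    have e1 : bp Y (μ.toMeasure.map π.map) 0 q v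
        = (∑ i ∈ Finset.range (N + q), bp Y (ν.toMeasure.map π.map) i q v) / ((N + q : ℕ) : ℝ) := by
      unfold bp
      rw [map_measureReal_apply π.measurable_map
        (blk_measurable Y 0 q (measurableSet_singleton v)),
        hμ _ (π.measurable_map (blk_measurable Y 0 q (measurableSet_singleton v)))]
      congr 1
      refine Finset.sum_congr rfl fun i _ => ?_
      rw [map_measureReal_apply π.measurable_map
        (blk_measurable Y i q (measurableSet_singleton v))]
      congr 1
      ext x
      simp only [mem_preimage, mem_singleton_iff, blk_pi, blk_sig, add_zero]
    have e2 : bp Y m.toMeasure 0 q v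
        = (∑ i ∈ Finset.range (N + q), bp Y m.toMeasure 0 q v) / ((N + q : ℕ) : ℝ) := by
      rw [Finset.sum_const, Finset.card_range, nsmul_eq_mul, mul_div_cancel_left₀ _ hn'.ne']
    rw [e1, e2, ← sub_div, ← Finset.sum_sub_distrib, abs_div, abs_of_pos hn']
    gcongr
    rw [Finset.sum_range_add, Finset.sum_eq_zero, zero_add]
    · calc _ ≤ ∑ i ∈ Finset.range q, (1 : ℝ) :=
            (Finset.abs_sum_le_sum_abs _ _).trans
              (Finset.sum_le_sum fun i _ => bp_diff_le Y _ _ _ _ _ _)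
        _ = q := by simp
    · intro i hi
      have hi' := Finset.mem_range.mp hi
      rw [bp_eq_of_zero Y _ m.toMeasure (N + q) hν1 i q (by omega) v, bp_inv Y m hm, sub_self]

lemma isClopen_blk (X : Subshift A) (i l : ℕ) (w : Fin l → A) : IsClopen (blk X i l ⁻¹' {w}) :=
  (isClopen_discrete {w}).preimage (blk_continuous X i l)

lemma pi_continuous (π : Factor X Y) : Continuous π.map := by
  unfold Factor.map
  refine Continuous.subtype_mk ?_ _
  exact continuous_pi fun j =>
    continuous_of_discreteTopology.comp ((continuous_apply j).comp continuous_subtype_val)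

lemma tendsto_real_clopen {ι : Type*} {l : Filter ι} (μs : ι → ProbabilityMeasure X.pt)
    (μ : ProbabilityMeasure X.pt) (h : Tendsto μs l (𝓝 μ)) (S : Set X.pt) (hS : IsClopen S) :
    Tendsto (fun i => (μs i).toMeasure.real S) l (𝓝 (μ.toMeasure.real S)) := by
  have := ProbabilityMeasure.tendsto_measure_of_isClopen_of_tendsto h hS
  exact (NNReal.continuous_coe.tendsto _).comp this

/-- Existence of a lift of nearly (in fact exactly) maximal entropy. -/
lemma KS_lower (π : Factor X Y) (m : ProbabilityMeasure Y.pt) (hm : m ∈ invP Y) :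
    ∃ μ ∈ invP X, π.push μ = m ∧ KS Y m + ∫ y, relP' π y ∂m.toMeasure ≤ KS X μ := by
  have hcomp : CompactSpace X.pt := isCompact_iff_compactSpace.mp X.isClosed.isCompact
  choose μs h1 h2 h3 using fun n : ℕ => exists_approx π m hm (n + 1) (Nat.succ_pos n)
  set U : Ultrafilter ℕ := hyperfilter ℕ with hU
  have hUtop : (U : Filter ℕ) ≤ atTop := Nat.hyperfilter_le_atTop
  obtain ⟨μ, -, hμ⟩ := isCompact_univ.ultrafilter_le_nhds (U.map μs) (by simp)
  have ht : Tendsto μs U (𝓝 μ) := hμ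
  have hdiv : ∀ c : ℝ, Tendsto (fun n : ℕ => c / ((n + 1 : ℕ) : ℝ)) U (𝓝 0) := fun c =>
    ((tendsto_const_div_nat c).comp (tendsto_add_atTop_nat 1)).mono_left hUtop
  have hbt : ∀ i q w, Tendsto (fun n => bp X (μs n).toMeasure i q w) U
      (𝓝 (bp X μ.toMeasure i q w)) := fun i q w =>
    tendsto_real_clopen μs μ ht _ (isClopen_blk X i q w)
  have hinv : μ ∈ invP X := by
    change μ.toMeasure.map X.σ = μ.toMeasure
    have hpr : IsProbabilityMeasure (μ.toMeasure.map X.σ) :=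
      Measure.isProbabilityMeasure_map (sig_measurable X).aemeasurable
    refine measure_ext_bp X _ _ fun q w => ?_
    have e : bp X (μ.toMeasure.map X.σ) 0 q w = bp X μ.toMeasure 1 q w := by
      unfold bp
      rw [map_measureReal_apply (sig_measurable X)
        (blk_measurable X 0 q (measurableSet_singleton w))]
      rw [← blk_pre X 1 0 q w]
      rfl
    rw [e, ← sub_eq_zero, ← abs_eq_zero]
    have t := ((hbt 1 q w).sub (hbt 0 q w)).abs
    refine le_antisymm (le_of_tendsto_of_tendsto' t (hdiv 1) fun n => h2 n q w) (abs_nonneg _)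
  have hpush : π.push μ = m := by
    apply Subtype.ext
    change μ.toMeasure.map π.map = m.toMeasure
    have hpr : IsProbabilityMeasure (μ.toMeasure.map π.map) :=
      Measure.isProbabilityMeasure_map π.measurable_map.aemeasurable
    refine measure_ext_bp Y _ _ fun q v => ?_
    have e : ∀ μ : ProbabilityMeasure X.pt, bp Y (μ.toMeasure.map π.map) 0 q v
        = μ.toMeasure.real (π.map ⁻¹' (blk Y 0 q ⁻¹' {v})) := fun μ => by
      unfold bp
      rw [map_measureReal_apply π.measurable_map
        (blk_measurable Y 0 q (measurableSet_singleton v))]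
    have t := tendsto_real_clopen μs μ ht _ ((isClopen_blk Y 0 q v).preimage (pi_continuous π))
    simp_rw [← e] at t
    rw [← sub_eq_zero, ← abs_eq_zero]
    have t' := (t.sub_const (bp Y m.toMeasure 0 q v)).abs
    refine le_antisymm (le_of_tendsto_of_tendsto t' (hdiv q) ?_) (abs_nonneg _)
    filter_upwards [hUtop (eventually_ge_atTop q)] with n hn
    exact h3 n q v (Nat.le_succ_of_le hn)
  refine ⟨μ, hinv, hpush, ?_⟩
  set L := KS Y m + ∫ y, relP' π y ∂m.toMeasure with hL
  have hHt : ∀ q, Tendsto (fun n => bH X (μs n).toMeasure 0 q) U (𝓝 (bH X μ.toMeasure 0 q)) :=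
    fun q => tendsto_finsetSum _ fun w _ =>
      (Real.continuous_negMulLog.tendsto _).comp (hbt 0 q w)
  have hmain : ∀ q : ℕ, q * L ≤ bH X μ.toMeasure 0 q := by
    intro q
    have t := (hHt q).add (hdiv (2 * (q : ℝ) ^ 2 * Real.log (Fintype.card A)))
    rw [add_zero] at t
    refine ge_of_tendsto t ?_
    filter_upwards [hUtop (eventually_ge_atTop q)] with n hn
    have hn1 : (0 : ℝ) < ((n + 1 : ℕ) : ℝ) := by positivity
    have a1 := h1 n q (Nat.le_succ_of_le hn)
    have a2 := KS_le Y m (n + 1) (Nat.succ_pos n)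
    have a3 := relP'_le π m hm (n + 1) (Nat.succ_pos n)
    rw [le_div_iff₀ hn1] at a2
    have a4 : ((n + 1 : ℕ) : ℝ) * L
        ≤ bH Y m.toMeasure 0 (n + 1) + ∫ y, lcnt π (n + 1) y ∂m.toMeasure := by
      rw [hL, mul_add]; linarith
    have a5 := (mul_le_mul_of_nonneg_left a4 (Nat.cast_nonneg (α := ℝ) q)).trans a1
    rw [← sub_nonneg]
    have e : bH X (μs n).toMeasure 0 q
          + 2 * (q : ℝ) ^ 2 * Real.log (Fintype.card A) / ((n + 1 : ℕ) : ℝ) - q * L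
        = (((n + 1 : ℕ) : ℝ) * bH X (μs n).toMeasure 0 q
          + 2 * (q : ℝ) ^ 2 * Real.log (Fintype.card A) - q * (((n + 1 : ℕ) : ℝ) * L))
          / ((n + 1 : ℕ) : ℝ) := by
      field_simp
    rw [e]
    exact div_nonneg (by linarith) hn1.le
  refine le_ciInf fun n => ?_
  rw [blockH_eq, le_div_iff₀ (by positivity)]
  have := hmain (n + 1)
  push_cast at this
  linarith

end Lower

section Final

variable {A B : Type*}
  [Fintype A] [TopologicalSpace A] [DiscreteTopology A]
  [MeasurableSpace A] [MeasurableSingletonClass A]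
  [Fintype B] [TopologicalSpace B] [DiscreteTopology B]
  [MeasurableSpace B] [MeasurableSingletonClass B]
  {X : Subshift A} {Y : Subshift B}

lemma integral_comp_identity (π : Factor X Y) (φ : Y.pt → ℝ) (hφ : Continuous φ)
    (μ : ProbabilityMeasure X.pt) :
    ∫ x, (-relP' π (π.map x) + φ (π.map x)) ∂μ.toMeasure
      = -∫ y, relP' π y ∂(π.push μ).toMeasure + ∫ y, φ y ∂(π.push μ).toMeasure := by
  have hcomp : CompactSpace Y.pt := isCompact_iff_compactSpace.mp Y.isClosed.isCompact
  obtain ⟨C, hC⟩ := (isCompact_univ (X := Y.pt)).exists_bound_of_continuousOn hφ.continuousOn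
  have hφm : Measurable φ := hφ.measurable
  have h1 : Integrable (relP' π) (π.push μ).toMeasure :=
    integrable_of_bdd _ _ (relP'_measurable π) _ (relP'_abs π)
  have h2 : Integrable φ (π.push μ).toMeasure :=
    integrable_of_bdd _ _ hφm C fun y => hC y (mem_univ y)
  have h3 : Measurable fun y => -relP' π y + φ y := (relP'_measurable π).neg.add hφm
  have h4 : ∫ y, (-relP' π y + φ y) ∂(π.push μ).toMeasure
      = ∫ x, (-relP' π (π.map x) + φ (π.map x)) ∂μ.toMeasure :=
    integral_map π.measurable_map.aemeasurable h3.aestronglyMeasurable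
  rw [← h4, integral_add h1.fun_neg h2, integral_neg]

end Final

/-- (Corollary: when `X` is an irreducible shift of finite type,
`|D_n(y)|` may be replaced by `|π⁻¹[y₁⋯yₙ]|`; in particular
`-F'∘π`, with `F'(y) = limsup (1/n) log |π⁻¹[y₁⋯yₙ]|`, is a bounded Borel measurable
saturated compensation function). -/
theorem statement5
    {A B : Type*}
    [Fintype A] [TopologicalSpace A] [DiscreteTopology A]
    [MeasurableSpace A] [MeasurableSingletonClass A]
    [Fintype B] [TopologicalSpace B] [DiscreteTopology B]
    [MeasurableSpace B] [MeasurableSingletonClass B]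
    (X : Subshift A) (Y : Subshift B) (π : Factor X Y)
    (hSFT : IsSFT X) (hIrr : Irr X) :
    -- `F'` is bounded (by `log S`) and Borel measurable
    (∀ y : Y.pt, |relP' π y| ≤ Real.log (Fintype.card A)) ∧
    Measurable (relP' π) ∧
    -- `-F'∘π` is a saturated compensation function
    (∀ φ : Y.pt → ℝ, Continuous φ →
      sSup (wtF X (fun x => -relP' π (π.map x) + φ (π.map x)) '' invP X)
        = sSup (wtF Y φ '' invP Y)) := by
  refine ⟨relP'_abs π, relP'_measurable π, fun φ hφ => le_antisymm ?_ ?_⟩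
  · refine sSup_le ?_
    rintro _ ⟨μ, hμ, rfl⟩
    refine le_trans ?_ (le_sSup (mem_image_of_mem _ (push_inv π μ hμ)))
    have h := KS_upper π μ hμ
    unfold wtF
    rw [integral_comp_identity π φ hφ μ, ← EReal.coe_add, ← EReal.coe_add]
    exact EReal.coe_le_coe_iff.mpr (by linarith)
  · refine sSup_le ?_
    rintro _ ⟨m, hm, rfl⟩
    obtain ⟨μ, hμ, hpush, h⟩ := KS_lower π m hm
    refine le_trans ?_ (le_sSup (mem_image_of_mem _ hμ))
    unfold wtF
    rw [integral_comp_identity π φ hφ μ, hpush, ← EReal.coe_add, ← EReal.coe_add]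
    exact EReal.coe_le_coe_iff.mpr (by linarith)

end Paper
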